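/- Every signed graph (G,σ) on a finite simple graph G with mad(G) < 14/5 admits a homomorphism to (K_6,M). -/

import Mathlib

open SimpleGraph

/-- The sign of a walk in a signed graph `(G, σ)`: the product of the signs of its edges,
counted with multiplicity. -/
def walkSign {V : Type*} {G : SimpleGraph V} (σ : Sym2 V → ℤˣ) {u v : V}
    (w : G.Walk u v) : ℤˣ :=
  (w.edges.map σ).prod

/-- A homomorphism of signed graphs: a graph homomorphism which preserves the signs of
closed walks. -/
def IsSignedHom {U V : Type*} (G : SimpleGraph U) (σ : Sym2 U → ℤˣ)
    (H : SimpleGraph V) (π : Sym2 V → ℤˣ) (f : G →g H) : Prop :=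
  ∀ (u : U) (w : G.Walk u u), walkSign π (w.map f) = walkSign σ w

/-- `(G, σ)` admits a homomorphism to `(H, π)`. -/
def SignedHom {U V : Type*} (G : SimpleGraph U) (σ : Sym2 U → ℤˣ)
    (H : SimpleGraph V) (π : Sym2 V → ℤˣ) : Prop :=
  ∃ f : G →g H, IsSignedHom G σ H π f

/-- The signature on the complete graph `K_n` (with `n` even, vertices `0, …, n-1`) whose
negative edges form the perfect matching `{01, 23, 45, …}`: the edge `uv` is negative iff
`u` and `v` lie in the same matched pair, i.e. `⌊u/2⌋ = ⌊v/2⌋`. For `n = 6` this is the signed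
graph `(K_6, M)` with negative edges `12, 34, 56`. -/
def matchSign (n : ℕ) : Sym2 (Fin n) → ℤˣ :=
  Sym2.lift ⟨fun a b => if (a : ℕ) / 2 = (b : ℕ) / 2 then -1 else 1, by
    intro a b
    simp only [eq_comm]⟩

/-- `MadLT G r` says that the maximum average degree of `G` is (strictly) less than `r`:
every nonempty subgraph `H` satisfies `2|E(H)| < r·|V(H)|`. -/
def MadLT {V : Type*} (G : SimpleGraph V) (r : ℚ) : Prop :=
  ∀ H : G.Subgraph, H.verts.Nonempty →
    (2 * H.edgeSet.ncard : ℚ) < r * (H.verts.ncard : ℚ)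

/-! ### Colours and finite facts -/

namespace K6M

/-- Colours: `4 p + 2 ε + s`. -/
abbrev Col := Fin 12
/-- Classes: `2 p + s`. -/
abbrev Cls := Fin 6

def cls (a : Col) : Cls := ⟨2 * (a.val / 4) + a.val % 2, by omega⟩

/-- Compatibility of two colours along an edge (`n = true` : negative edge). -/
def ok (n : Bool) (a b : Col) : Bool :=
  !(Nat.beq (Nat.div a.val 2) (Nat.div b.val 2)) &&
    (xor (xor (Nat.beq (Nat.mod a.val 2) (Nat.mod b.val 2))
      (Nat.beq (Nat.div a.val 4) (Nat.div b.val 4))) n)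

def ng (l : Cls) : Cls := ⟨2 * (l.val / 2) + (1 - l.val % 2), by omega⟩

def tw (n : Bool) (l : Cls) : Cls := if n then l else ng l

/-- class-level compatibility -/
def adj (n : Bool) (l m : Cls) : Bool :=
  xor (xor (Nat.beq (Nat.mod l.val 2) (Nat.mod m.val 2))
    (Nat.beq (Nat.div l.val 2) (Nat.div m.val 2))) n

def anyC (p : Cls → Bool) : Bool :=
  p ⟨0, by decide⟩ || p ⟨1, by decide⟩ || p ⟨2, by decide⟩ || p ⟨3, by decide⟩ ||
    p ⟨4, by decide⟩ || p ⟨5, by decide⟩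
def allC (p : Cls → Bool) : Bool :=
  p ⟨0, by decide⟩ && p ⟨1, by decide⟩ && p ⟨2, by decide⟩ && p ⟨3, by decide⟩ &&
    p ⟨4, by decide⟩ && p ⟨5, by decide⟩
def allB (p : Bool → Bool) : Bool := p false && p true
def eqC (a b : Cls) : Bool := Nat.beq a.val b.val

lemma anyC_iff (p : Cls → Bool) : anyC p = true ↔ ∃ x, p x = true := by
  simp [anyC, Fin.exists_fin_succ, or_assoc]
lemma allC_iff (p : Cls → Bool) : allC p = true ↔ ∀ x, p x = true := by
  simp [allC, Fin.forall_fin_succ, and_assoc]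
lemma allB_iff (p : Bool → Bool) : allB p = true ↔ ∀ x, p x = true := by
  simp [allB]
lemma eqC_iff (a b : Cls) : eqC a b = true ↔ a = b := by
  simp only [eqC, Fin.ext_iff]
  exact ⟨Nat.eq_of_beq_eq_true, fun h => h ▸ Nat.beq_refl _⟩
def anyE (p : Col → Bool) : Bool :=
  p ⟨0, by decide⟩ || p ⟨1, by decide⟩ || p ⟨2, by decide⟩ || p ⟨3, by decide⟩ ||
    p ⟨4, by decide⟩ || p ⟨5, by decide⟩ || p ⟨6, by decide⟩ || p ⟨7, by decide⟩ ||
    p ⟨8, by decide⟩ || p ⟨9, by decide⟩ || p ⟨10, by decide⟩ || p ⟨11, by decide⟩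
def allE (p : Col → Bool) : Bool := !anyE fun c => !p c
lemma anyE_iff (p : Col → Bool) : anyE p = true ↔ ∃ x, p x = true := by
  simp [anyE, Fin.exists_fin_succ, or_assoc]
lemma allE_iff (p : Col → Bool) : allE p = true ↔ ∀ x, p x = true := by
  have h := anyE_iff fun c => !p c
  simp only [allE, Bool.not_eq_true', ← Bool.not_eq_true, h]
  simp
lemma not_iff (b : Bool) : (!b) = true ↔ ¬ b = true := by simp

/-- class `m` can be reached from a vertex coloured in class `l` through a vertex avoiding `τ` -/
def reach (n1 n2 : Bool) (l τ m : Cls) : Bool :=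
  anyC fun z => adj n1 l z && !(eqC z τ) && adj n2 z m &&
    !(Nat.beq (Nat.div z.val 2) (Nat.div l.val 2) && Nat.beq (Nat.div m.val 2) (Nat.div z.val 2))

/-- antiparallel pairs of classes -/
def AP (k l : Cls) : Bool := !(Nat.beq (Nat.div k.val 2) (Nat.div l.val 2)) && !(Nat.beq (Nat.mod k.val 2) (Nat.mod l.val 2))

lemma ok_symm (n : Bool) (a b : Col) : ok n a b = ok n b a := by
  revert n a b; decide +kernel

lemma tw_tw (n : Bool) (l : Cls) : tw n (tw n l) = l := by
  revert n l; decide +kernel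

lemma CL : ∀ n l y, adj n l (cls y) = true → ∃ b, cls b = l ∧ ok n b y = true := by
  decide +kernel
lemma CR : ∀ n c l, adj n (cls c) l = true → ∃ b, cls b = l ∧ ok n c b = true := by
  decide +kernel
lemma TT : ∀ n1 n2 c y, cls y ≠ tw (n1 ^^ n2) (cls c) → ∃ z, ok n1 c z = true ∧ ok n2 z y = true := by
  decide +kernel
lemma M1x : ∀ n1 n2 c τ y, reach n1 n2 (cls c) τ (cls y) = true →
    ∃ z, ok n1 c z = true ∧ cls z ≠ τ ∧ ok n2 z y = true := by
  decide +kernel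
lemma FA : ∀ n l κ1 κ2, ∃ m, adj n l m = true ∧ m ≠ κ1 ∧ m ≠ κ2 := by
  decide +kernel
lemma FB1 : ∀ n l κ κ0, ∃ m, adj n l m = true ∧ m ≠ κ ∧ m ≠ ng κ ∧ m ≠ κ0 := by
  decide +kernel
lemma P5 (k1 k2 k3 k4 k5 : Cls) : ∃ m : Cls, m ≠ k1 ∧ m ≠ k2 ∧ m ≠ k3 ∧ m ≠ k4 ∧ m ≠ k5 := by
  have h : ({k1, k2, k3, k4, k5} : Finset Cls).card < (Finset.univ : Finset Cls).card :=
    lt_of_le_of_lt Finset.card_le_five (by simp)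
  obtain ⟨m, -, hm⟩ := Finset.exists_mem_notMem_of_card_lt_card h
  refine ⟨m, ?_⟩
  simpa using hm
lemma M1 : ∀ n1 n2 l τ, ∃ κ1 κ2, AP κ1 κ2 = true ∧
    ∀ m, m ≠ κ1 → m ≠ κ2 → reach n1 n2 l τ m = true := by
  decide +kernel
lemma M1g : ∀ n1 τ, ∃ κ1 κ2, ∀ l, l ≠ κ1 → l ≠ κ2 → ∀ n2, ∃ κ0, ∀ m, m ≠ κ0 →
    reach n1 n2 l τ m = true := by
  decide +kernel
lemma M1g' : ∀ n1 n2 n l, ∃ κ0, ∀ m, m ≠ κ0 → reach n1 n2 l (tw n l) m = true := by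
  decide +kernel
lemma M1t : ∀ n1 n2 l, ∃ κ1 κ2, ∀ k, k ≠ κ1 → k ≠ κ2 → ∃ κ0, ∀ m, m ≠ κ0 →
    reach n1 n2 l k m = true := by
  decide +kernel
lemma M2 : ∀ κ1 κ2, AP κ1 κ2 = true → ∀ n τ, ∃ κ', ∀ y, y ≠ κ' →
    ∃ b, b ≠ κ1 ∧ b ≠ κ2 ∧ b ≠ τ ∧ adj n b y = true := by
  decide +kernel
lemma FC : ∀ n κ0 τ y, ∃ b, b ≠ κ0 ∧ b ≠ τ ∧ adj n b y = true := by
  decide +kernel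
lemma M3 : ∀ κ1 κ2, AP κ1 κ2 = true → ∃ κ', ∀ k, k ≠ κ' → k ≠ ng κ' → ∀ n y,
    ∃ b, b ≠ κ1 ∧ b ≠ κ2 ∧ b ≠ k ∧ adj n b y = true := by
  decide +kernel
lemma G1 : ∀ n1 n2 l τ, ∃ κ', ∀ k, k ≠ κ' → ∀ n y,
    ∃ b, reach n1 n2 l k b = true ∧ b ≠ τ ∧ adj n b y = true := by
  have h : (allB fun n1 => allB fun n2 => allC fun l => allC fun τ => anyC fun κ' => allC fun k =>
      eqC k κ' || allB fun n => allC fun y => anyC fun b =>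
        reach n1 n2 l k b && (!eqC b τ && adj n b y)) = true := by
    decide +kernel
  simp only [allB_iff, allC_iff, anyC_iff, Bool.or_eq_true, Bool.and_eq_true, eqC_iff,
    not_iff] at h
  intro n1 n2 l τ
  obtain ⟨κ', h⟩ := h n1 n2 l τ
  exact ⟨κ', fun k hk n y => (h k).resolve_left hk n y⟩
lemma M4 : ∀ κ1 κ2, AP κ1 κ2 = true → ∀ κ3 κ4, AP κ3 κ4 = true → ∀ n, ∃ κ5 κ6, AP κ5 κ6 = true ∧
    ∀ m, m ≠ κ5 → m ≠ κ6 →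
      ∃ z, z ≠ κ1 ∧ z ≠ κ2 ∧ z ≠ κ3 ∧ z ≠ κ4 ∧ adj n z m = true := by
  decide +kernel
lemma M5 : ∀ κ3 κ4, AP κ3 κ4 = true → ∀ κ0 n, ∃ κ', ∀ m, m ≠ κ' →
      ∃ z, z ≠ κ0 ∧ z ≠ κ3 ∧ z ≠ κ4 ∧ adj n z m = true := by
  decide +kernel
lemma G2 : ∀ n1 n2 l κ3 κ4, AP κ3 κ4 = true → ∃ κ', ∀ k, k ≠ κ' → ∀ n, ∃ κ'', ∀ m, m ≠ κ'' →
      ∃ z, reach n1 n2 l k z = true ∧ z ≠ κ3 ∧ z ≠ κ4 ∧ adj n z m = true := by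
  have h : (allB fun n1 => allB fun n2 => allC fun l => allC fun κ3 => allC fun κ4 => !AP κ3 κ4 ||
      anyC fun κ' => allC fun k => eqC k κ' || allB fun n => anyC fun κ'' => allC fun m =>
        eqC m κ'' || anyC fun z =>
          reach n1 n2 l k z && (!eqC z κ3 && (!eqC z κ4 && adj n z m))) = true := by
    decide +kernel
  simp only [allB_iff, allC_iff, anyC_iff, Bool.or_eq_true, Bool.and_eq_true, eqC_iff,
    not_iff] at h
  intro n1 n2 l κ3 κ4 hA
  obtain ⟨κ', h⟩ := (h n1 n2 l κ3 κ4).resolve_left (fun e => e hA)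
  refine ⟨κ', fun k hk n => ?_⟩
  obtain ⟨κ2, h⟩ := (h k).resolve_left hk n
  exact ⟨κ2, fun m hm => (h m).resolve_left hm⟩
lemma FS1 : ∀ n1 n2 n3 n c c', ∃ a b, ok n1 c a = true ∧ ok n2 c' b = true ∧ ok n3 a b = true ∧
    cls b ≠ tw n (cls a) := by
  have h : (allB fun n1 => allB fun n2 => allB fun n3 => allB fun n => allE fun c => allE fun c' =>
      anyE fun a => ok n1 c a && anyE fun b =>
        ok n2 c' b && (ok n3 a b && !eqC (cls b) (tw n (cls a)))) = true := by
    decide +kernel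
  simp only [allB_iff, allE_iff, anyE_iff, Bool.and_eq_true, eqC_iff, not_iff] at h
  intro n1 n2 n3 n c c'
  obtain ⟨a, h1, b, h2⟩ := h n1 n2 n3 n c c'
  exact ⟨a, b, h1, h2⟩
lemma FS3 : ∀ n1 n2 n3 n4 n l l' κ3 κ4, AP κ3 κ4 = true → ∃ b, adj n3 l' b = true ∧
    ∃ z, z ≠ κ3 ∧ z ≠ κ4 ∧ reach n1 n2 l (tw n b) z = true ∧ adj n4 z b = true := by
  have h : (allB fun n1 => allB fun n2 => allB fun n3 => allB fun n4 => allB fun n =>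
      allC fun l => allC fun l' => allC fun κ3 => allC fun κ4 => !AP κ3 κ4 ||
        anyC fun b => adj n3 l' b && anyC fun z =>
          !eqC z κ3 && (!eqC z κ4 && (reach n1 n2 l (tw n b) z && adj n4 z b))) = true := by
    decide +kernel
  simp only [allB_iff, allC_iff, anyC_iff, Bool.or_eq_true, Bool.and_eq_true, eqC_iff,
    not_iff] at h
  intro n1 n2 n3 n4 n l l' κ3 κ4 hA
  exact (h n1 n2 n3 n4 n l l' κ3 κ4).resolve_left (fun e => e hA)
lemma FS4 : ∀ n1 n2 n l κ1 κ2, ∃ b, adj n1 l b = true ∧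
    ∃ z, z ≠ κ1 ∧ z ≠ κ2 ∧ z ≠ tw n b ∧ adj n2 b z = true := by
  decide +kernel

end K6M

/-! ### Abstract constraint systems -/

namespace K6M

/-- An abstract constraint system: edges `A` with signs `s`, and `2`-paths `tc`. -/
structure Ctx (B : Type*) where
  A : B → B → Prop
  s : B → B → Bool
  tc : B → B → Bool → Prop
  A_symm : ∀ {a b}, A a b → A b a
  A_irr : ∀ a, ¬ A a a
  s_symm : ∀ a b, s a b = s b a
  tc_symm : ∀ {a b n}, tc a b n → tc b a n
  tc_irr : ∀ a n, ¬ tc a a n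

variable {B : Type*} (C : Ctx B)

def Red (S : B → Prop) : Prop :=
  ∀ f : B → Col, ∃ g : B → Col, (∀ x, ¬ S x → g x = f x) ∧
    ∀ x, S x → (∀ y, C.A x y → ok (C.s x y) (g x) (g y) = true) ∧
      (∀ y n, C.tc x y n → cls (g x) ≠ tw n (cls (g y)))

def Irr : Prop := ∀ S : B → Prop, (∃ x y, S x ∧ C.A x y) → ¬ Red C S

structure UN (v : B) (n : Bool) (o a b : B) : Prop where
  tcs : ∀ y m, C.tc v y m ↔ y = o ∧ m = n
  nb : ∀ y, C.A v y ↔ y = a ∨ y = b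
  ne : a ≠ b

def IsU (v : B) : Prop := ∃ n o a b, UN C v n o a b

structure XN (x a b c : B) : Prop where
  tcs : ∀ y m, ¬ C.tc x y m
  nb : ∀ y, C.A x y ↔ y = a ∨ y = b ∨ y = c
  hab : a ≠ b
  hac : a ≠ c
  hbc : b ≠ c

def In (S : B → Prop) (v w : B) (f : B → Col) (y : Col) : Prop :=
  ∃ g : B → Col, (∀ x, ¬ S x → g x = f x) ∧
    (∀ x, S x → (∀ y, C.A x y → ¬ (x = v ∧ y = w) → ok (C.s x y) (g x) (g y) = true) ∧
      (∀ y n, C.tc x y n → cls (g x) ≠ tw n (cls (g y)))) ∧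
    ok (C.s v w) (g v) y = true

/-- a vertex is a source of `S` (with exit dart `v → w`). -/
def Src (S : B → Prop) (v w w' : B) : Prop :=
  ¬ S w' ∧ ∃ x, S x ∧ ((C.A x w' ∧ ¬ (x = v ∧ w' = w)) ∨ ∃ n, C.tc x w' n)

noncomputable def upd (f : B → Col) (w : B) (b : Col) : B → Col := by
  classical exact fun q => if q = w then b else f q

lemma upd_same (f : B → Col) (w : B) (b : Col) : upd f w b w = b := by simp [upd]
lemma upd_ne (f : B → Col) (w : B) (b : Col) (q : B) (h : q ≠ w) : upd f w b q = f q := by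
  simp [upd, h]

structure Inv (S : B → Prop) (v w : B) : Prop where
  hv : S v
  hw : ¬ S w
  hA : C.A v w
  i1 : ∀ f, ∃ κ, ∀ y, cls y ≠ κ → In C S v w f y
  i2R : ∀ w', Src C S v w w' → ∀ f, ∃ κ1 κ2, ∀ b, cls b ≠ κ1 → cls b ≠ κ2 →
    ∀ y, In C S v w (upd f w' b) y
  i2T : ∀ w', Src C S v w w' → IsU C w' → (∀ x, S x → C.A x w' → (x = v ∧ w' = w)) →
    ∀ f, ∃ κ, ∀ b, cls b ≠ κ → cls b ≠ ng κ → ∀ y, In C S v w (upd f w' b) y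

variable {C}

lemma tw_ng (n : Bool) (l : Cls) : tw n (ng l) = ng (tw n l) := by
  revert n l; decide +kernel

lemma tw_ne {n : Bool} {l m : Cls} (h : l ≠ tw n m) : tw n l ≠ m := by
  intro e; apply h; rw [← e, tw_tw]

lemma cls_surj : ∀ l, ∃ c, cls c = l := by decide +kernel

lemma UN.swap {v n o a b} (h : UN C v n o a b) : UN C v n o b a :=
  ⟨h.tcs, fun y => by rw [h.nb]; tauto, h.ne.symm⟩

lemma XN.swap {x a b c} (h : XN C x a b c) : XN C x a c b :=
  ⟨h.tcs, fun y => by rw [h.nb]; tauto, h.hac, h.hab, h.hbc.symm⟩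

lemma XN.swap' {x a b c} (h : XN C x a b c) : XN C x b a c :=
  ⟨h.tcs, fun y => by rw [h.nb]; tauto, h.hab.symm, h.hbc, h.hac⟩

lemma IsU.of_adj {v w} (h : IsU C v) (hw : C.A v w) : ∃ n o b, UN C v n o w b := by
  obtain ⟨n, o, a, b, h⟩ := h
  rcases (h.nb w).1 hw with rfl | rfl
  · exact ⟨_, _, _, h⟩
  · exact ⟨_, _, _, h.swap⟩

lemma ok_symm' (C : Ctx B) {a b : B} {c d : Col} (h : ok (C.s a b) c d = true) :
    ok (C.s b a) d c = true := by
  rw [C.s_symm, ok_symm]; exact h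

lemma tc_symm' {n : Bool} {l m : Cls} (h : l ≠ tw n m) : m ≠ tw n l := by
  intro e; exact tw_ne h e.symm

lemma In.congr {S : B → Prop} {v w : B} {f f' : B → Col} {y : Col} (h : In C S v w f y)
    (hv : S v) (hf : ∀ q, Src C S v w q → f' q = f q) : In C S v w f' y := by
  classical
  obtain ⟨g, h1, h2, h3⟩ := h
  refine ⟨fun q => if S q then g q else f' q, ?_, ?_, ?_⟩
  · intro x hx; simp [hx]
  · intro x hx
    refine ⟨fun y hy hn => ?_, fun y n hy => ?_⟩
    · by_cases hS : S y
      · simpa [hx, hS] using (h2 x hx).1 y hy hn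
      · have := (h2 x hx).1 y hy hn
        rw [h1 y hS, ← hf y ⟨hS, x, hx, Or.inl ⟨hy, hn⟩⟩] at this
        simpa [hx, hS] using this
    · by_cases hS : S y
      · simpa [hx, hS] using (h2 x hx).2 y n hy
      · have := (h2 x hx).2 y n hy
        rw [h1 y hS, ← hf y ⟨hS, x, hx, Or.inr ⟨n, hy⟩⟩] at this
        simpa [hx, hS] using this
  · simpa [hv] using h3

end K6M

/-! ### Closing lemmas -/

namespace K6M

variable {B : Type*} {C : Ctx B}

lemma closeX (hI : Irr C) {S : B → Prop} {v x b c : B} (h : Inv C S v x) (hx : XN C x v b c)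
    (hb : S b) : False := by
  apply hI (fun q => S q ∨ q = x) ⟨x, b, Or.inr rfl, (hx.nb b).2 (by tauto)⟩
  intro f
  have hAbx : C.A b x := C.A_symm ((hx.nb b).2 (by tauto))
  obtain ⟨κ1, κ2, hk⟩ := h.i2R x ⟨h.hw, b, hb, Or.inl ⟨hAbx, fun e => hx.hab e.1.symm⟩⟩ f
  obtain ⟨m, hm, hm1, hm2⟩ := FA (C.s c x) (cls (f c)) κ1 κ2
  obtain ⟨z, rfl, hz⟩ := CR _ _ _ hm
  obtain ⟨g, h1, h2, h3⟩ := hk z hm1 hm2 z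
  have hgx : g x = z := by rw [h1 x h.hw, upd_same]
  refine ⟨g, fun q hq => ?_, fun q hq => ?_⟩
  · rw [h1 q (by tauto), upd_ne _ _ _ _ (by tauto)]
  · have key : ∀ q, S q → ∀ y, C.A q y → ok (C.s q y) (g q) (g y) = true := by
      intro q hq y hy
      by_cases he : q = v ∧ y = x
      · obtain ⟨rfl, rfl⟩ := he; rw [hgx]; exact h3
      · exact (h2 q hq).1 y hy he
    rcases hq with hq | rfl
    · exact ⟨key q hq, (h2 q hq).2⟩
    · refine ⟨fun y hy => ?_, fun y n hy => absurd hy (hx.tcs y n)⟩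
      by_cases hS : S y
      · exact ok_symm' C (key y hS q (C.A_symm hy))
      · have hyc : y = c := by
          rcases (hx.nb y).1 hy with rfl | rfl | rfl
          · exact absurd h.hv hS
          · exact absurd hb hS
          · rfl
        subst hyc
        have hne : y ≠ q := by rintro rfl; exact C.A_irr _ hy
        rw [hgx, h1 y hS, upd_ne _ _ _ _ hne]
        exact ok_symm' C hz

/-- completing a colouring at `x`, where `u` is already coloured -/
lemma closeU_aux (hI : Irr C) {S : B → Prop} {v x u y3 o w2 : B} {n : Bool} (h : Inv C S v x)
    (hx : XN C x v u y3) (hu : UN C u n o x w2) (hSu : ¬ S u) (hSy : ¬ S y3)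
    (hcase : ∀ f : B → Col, ∃ b, (S w2 ∨ ok (C.s w2 u) (f w2) b = true) ∧
      (S o ∨ cls b ≠ tw n (cls (f o))) ∧ cls b ≠ tw (C.s y3 x ^^ C.s x u) (cls (f y3)) ∧
      ∀ z, In C S v x (upd f u b) z) : False := by
  apply hI (fun q => S q ∨ q = x ∨ q = u) ⟨x, u, by tauto, (hx.nb u).2 (by tauto)⟩
  intro f
  obtain ⟨b, hb1, hb2, hb3, hb4⟩ := hcase f
  obtain ⟨z, hz1, hz2⟩ := TT _ _ _ _ hb3
  obtain ⟨g, h1, h2, h3⟩ := hb4 z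
  have hxu : x ≠ u := by rintro rfl; exact C.A_irr x ((hx.nb x).2 (by tauto))
  have hy3x : y3 ≠ x := by rintro rfl; exact C.A_irr y3 ((hx.nb y3).2 (by tauto))
  have hvx : v ≠ x := by rintro rfl; exact h.hw h.hv
  have hgu : g u = b := by rw [h1 u hSu, upd_same]
  have hgy : g y3 = f y3 := by rw [h1 y3 hSy, upd_ne _ _ _ _ hx.hbc.symm]
  have hne : ∀ q, S q → q ≠ x := by rintro q hq rfl; exact h.hw hq
  have hne' : ∀ q, S q → q ≠ u := by rintro q hq rfl; exact hSu hq
  have hxS : ∀ q, S q → C.A q x → q = v := by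
    intro q hq hA
    rcases (hx.nb q).1 (C.A_symm hA) with e | e | e
    · exact e
    · exact absurd e (hne' q hq)
    · subst e; exact absurd hq hSy
  have keyA : ∀ q, S q → ∀ y, C.A q y → ok (C.s q y) (upd g x z q) (upd g x z y) = true := by
    intro q hq y hy
    rw [upd_ne _ _ _ q (hne q hq)]
    by_cases he : y = x
    · subst he
      obtain rfl := hxS q hq hy
      rw [upd_same]; exact h3
    · rw [upd_ne _ _ _ _ he]
      exact (h2 q hq).1 y hy (by tauto)
  have keyT : ∀ q, S q → ∀ y n, C.tc q y n → cls (upd g x z q) ≠ tw n (cls (upd g x z y)) := by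
    intro q hq y n hy
    rw [upd_ne _ _ _ q (hne q hq)]
    have he : y ≠ x := by rintro rfl; exact hx.tcs _ _ (C.tc_symm hy)
    rw [upd_ne _ _ _ _ he]
    exact (h2 q hq).2 y n hy
  refine ⟨upd g x z, fun q hq => ?_, fun q hq => ?_⟩
  · rw [upd_ne _ _ _ _ (by tauto), h1 q (by tauto), upd_ne _ _ _ _ (by tauto)]
  · rcases hq with hq | rfl | rfl
    · exact ⟨keyA q hq, keyT q hq⟩
    · refine ⟨fun y hy => ?_, fun y n hy => absurd hy (hx.tcs y n)⟩
      rcases (hx.nb y).1 hy with rfl | rfl | rfl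
      · exact ok_symm' C (keyA _ h.hv _ (C.A_symm hy))
      · rw [upd_same, upd_ne _ _ _ _ hxu.symm, hgu]; exact hz2
      · rw [upd_same, upd_ne _ _ _ _ hy3x, hgy]; exact ok_symm' C hz1
    · refine ⟨fun y hy => ?_, fun y m hy => ?_⟩
      · by_cases hS : S y
        · exact ok_symm' C (keyA _ hS _ (C.A_symm hy))
        rcases (hu.nb y).1 hy with rfl | rfl
        · rw [upd_same, upd_ne _ _ _ _ hxu.symm, hgu]; exact ok_symm' C hz2
        · have e1 : y ≠ x := hu.ne.symm
          have e2 : y ≠ q := by rintro rfl; exact C.A_irr _ hy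
          rw [upd_ne _ _ _ _ hxu.symm, hgu, upd_ne _ _ _ _ e1, h1 y hS, upd_ne _ _ _ _ e2]
          exact ok_symm' C (hb1.resolve_left hS)
      · by_cases hS : S y
        · exact tc_symm' (keyT _ hS _ _ (C.tc_symm hy))
        obtain ⟨rfl, rfl⟩ := (hu.tcs y m).1 hy
        have e1 : y ≠ x := by rintro rfl; exact hx.tcs _ _ (C.tc_symm hy)
        have e2 : y ≠ q := by rintro rfl; exact C.tc_irr _ _ hy
        rw [upd_ne _ _ _ _ hxu.symm, hgu, upd_ne _ _ _ _ e1, h1 y hS, upd_ne _ _ _ _ e2]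
        exact hb2.resolve_left hS

lemma closeU (hI : Irr C) {S : B → Prop} {v x u y3 o w2 : B} {n : Bool} (h : Inv C S v x)
    (hx : XN C x v u y3) (hu : UN C u n o x w2) (hS : S o ∨ S w2) : False := by
  have hSu : ¬ S u := fun hb => closeX hI h hx hb
  have hSy : ¬ S y3 := fun hb => closeX hI h hx.swap hb
  have hxu : x ≠ u := by rintro rfl; exact C.A_irr x ((hx.nb x).2 (by tauto))
  refine closeU_aux hI h hx hu hSu hSy fun f => ?_
  by_cases hw : S w2
  · have hA : C.A w2 u := C.A_symm ((hu.nb w2).2 (by tauto))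
    obtain ⟨κ1, κ2, hk⟩ := h.i2R u ⟨hSu, w2, hw, Or.inl ⟨hA, by tauto⟩⟩ f
    obtain ⟨m, e1, e2, e3, e4, -⟩ := P5 κ1 κ2 (tw n (cls (f o)))
      (tw (C.s y3 x ^^ C.s x u) (cls (f y3))) κ1
    obtain ⟨b, rfl⟩ := cls_surj m
    exact ⟨b, Or.inl hw, Or.inr e3, e4, hk b e1 e2⟩
  · have ho : S o := hS.resolve_right hw
    have htc : C.tc o u n := C.tc_symm ((hu.tcs o n).2 ⟨rfl, rfl⟩)
    obtain ⟨κ, hk⟩ := h.i2T u ⟨hSu, o, ho, Or.inr ⟨n, htc⟩⟩ ⟨_, _, _, _, hu⟩ (by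
      intro q hq hA
      rcases (hu.nb q).1 (C.A_symm hA) with rfl | rfl
      · exact absurd hq h.hw
      · exact absurd hq hw) f
    obtain ⟨m, hm, e1, e2, e3⟩ := FB1 (C.s w2 u) (cls (f w2)) κ
      (tw (C.s y3 x ^^ C.s x u) (cls (f y3)))
    obtain ⟨b, rfl, hb⟩ := CR _ _ _ hm
    exact ⟨b, Or.inr hb, Or.inl ho, e3, hk b e1 e2⟩

end K6M

/-! ### The propagation step -/

namespace K6M

variable {B : Type*} {C : Ctx B}

lemma step_comp {S : B → Prop} {v x u y3 o w2 : B} {n : Bool} (h : Inv C S v x)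
    (hx : XN C x v u y3) (hu : UN C u n o x w2) (hSu : ¬ S u) (hSy : ¬ S y3)
    (hSo : ¬ S o) (hSw : ¬ S w2) {f : B → Col} {z b y : Col} (hz : In C S v x f z)
    (h1 : ok (C.s y3 x) (f y3) z = true) (h2 : ok (C.s x u) z b = true)
    (h3 : cls b ≠ tw n (cls (f o))) (h4 : ok (C.s u w2) b y = true) :
    In C (fun q => S q ∨ q = x ∨ q = u) u w2 f y := by
  obtain ⟨g, k1, k2, k3⟩ := hz
  have hxu : x ≠ u := by rintro rfl; exact C.A_irr x ((hx.nb x).2 (by tauto))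
  have hy3x : y3 ≠ x := by rintro rfl; exact C.A_irr y3 ((hx.nb y3).2 (by tauto))
  have hne : ∀ q, S q → q ≠ x := by rintro q hq rfl; exact h.hw hq
  have hne' : ∀ q, S q → q ≠ u := by rintro q hq rfl; exact hSu hq
  have hox : o ≠ x := by rintro rfl; exact hx.tcs _ _ (C.tc_symm ((hu.tcs o n).2 ⟨rfl, rfl⟩))
  have hou : o ≠ u := by rintro rfl; exact C.tc_irr _ _ ((hu.tcs o n).2 ⟨rfl, rfl⟩)
  obtain ⟨g', e1, e2, e3⟩ : ∃ g' : B → Col, g' x = z ∧ g' u = b ∧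
      ∀ q, q ≠ x → q ≠ u → g' q = g q :=
    ⟨upd (upd g x z) u b, by rw [upd_ne _ _ _ _ hxu, upd_same], upd_same _ _ _,
      fun q q1 q2 => by rw [upd_ne _ _ _ _ q2, upd_ne _ _ _ _ q1]⟩
  have hxS : ∀ q, S q → C.A q x → q = v := by
    intro q hq hA
    rcases (hx.nb q).1 (C.A_symm hA) with e | e | e
    · exact e
    · exact absurd e (hne' q hq)
    · subst e; exact absurd hq hSy
  have keyA : ∀ q, S q → ∀ y, C.A q y → ok (C.s q y) (g' q) (g' y) = true := by
    intro q hq y hy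
    rw [e3 q (hne q hq) (hne' q hq)]
    by_cases he : y = x
    · subst he
      obtain rfl := hxS q hq hy
      rw [e1]; exact k3
    · have he' : y ≠ u := by
        rintro rfl
        rcases (hu.nb q).1 (C.A_symm hy) with rfl | rfl
        · exact h.hw hq
        · exact hSw hq
      rw [e3 y he he']
      exact (k2 q hq).1 y hy (by tauto)
  refine ⟨g', fun q hq => ?_, fun q hq => ?_, by rw [e2]; exact h4⟩
  · rw [e3 q (by tauto) (by tauto), k1 q (by tauto)]
  · rcases hq with hq | rfl | rfl
    · refine ⟨fun y hy _ => keyA q hq y hy, fun y m hy => ?_⟩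
      have he : y ≠ x := by rintro rfl; exact hx.tcs _ _ (C.tc_symm hy)
      have he' : y ≠ u := by
        rintro rfl
        obtain ⟨rfl, -⟩ := (hu.tcs q m).1 (C.tc_symm hy)
        exact hSo hq
      rw [e3 q (hne q hq) (hne' q hq), e3 y he he']
      exact (k2 q hq).2 y m hy
    · refine ⟨fun y hy _ => ?_, fun y n hy => absurd hy (hx.tcs y n)⟩
      rcases (hx.nb y).1 hy with rfl | rfl | rfl
      · exact ok_symm' C (keyA _ h.hv _ (C.A_symm hy))
      · rw [e1, e2]; exact h2
      · rw [e1, e3 y hy3x hx.hbc.symm, k1 y hSy]; exact ok_symm' C h1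
    · refine ⟨fun y hy hn => ?_, fun y m hy => ?_⟩
      · rcases (hu.nb y).1 hy with rfl | rfl
        · rw [e1, e2]; exact ok_symm' C h2
        · tauto
      · obtain ⟨rfl, rfl⟩ := (hu.tcs y m).1 hy
        rw [e2, e3 y hox hou, k1 y hSo]
        exact h3

lemma STEP (hI : Irr C) {S : B → Prop} {v x u y3 o w2 : B} {n : Bool} (h : Inv C S v x)
    (hx : XN C x v u y3) (hu : UN C u n o x w2) :
    Inv C (fun q => S q ∨ q = x ∨ q = u) u w2 := by
  have hSu : ¬ S u := fun hb => closeX hI h hx hb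
  have hSy : ¬ S y3 := fun hb => closeX hI h hx.swap hb
  have hSo : ¬ S o := fun hb => closeU hI h hx hu (Or.inl hb)
  have hSw : ¬ S w2 := fun hb => closeU hI h hx hu (Or.inr hb)
  have hxu : x ≠ u := by rintro rfl; exact C.A_irr x ((hx.nb x).2 (by tauto))
  have hAuw : C.A u w2 := (hu.nb w2).2 (by tauto)
  have hw2u : w2 ≠ u := by rintro rfl; exact C.A_irr _ hAuw
  -- class level composition
  have comp1 : ∀ (f : B → Col) (κ β : Cls) (y : Col), (∀ z, cls z ≠ κ → In C S v x f z) →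
      reach (C.s y3 x) (C.s x u) (cls (f y3)) κ β = true → β ≠ tw n (cls (f o)) →
      adj (C.s u w2) β (cls y) = true → In C (fun q => S q ∨ q = x ∨ q = u) u w2 f y := by
    intro f κ β y hκ hr hb ha
    obtain ⟨b, rfl, hby⟩ := CL _ _ _ ha
    obtain ⟨z, z1, z2, z3⟩ := M1x _ _ _ _ _ hr
    exact step_comp h hx hu hSu hSy hSo hSw (hκ z z2) z1 z3 hb hby
  have compA : ∀ (f : B → Col) (y : Col), (∀ z, In C S v x f z) →
      In C (fun q => S q ∨ q = x ∨ q = u) u w2 f y := by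
    intro f y hall
    obtain ⟨β, b1, b2, b3⟩ := FC (C.s u w2) (tw (C.s y3 x ^^ C.s x u) (cls (f y3)))
      (tw n (cls (f o))) (cls y)
    obtain ⟨b, rfl, hby⟩ := CL _ _ _ b3
    obtain ⟨z, z1, z2⟩ := TT _ _ _ _ b1
    exact step_comp h hx hu hSu hSy hSo hSw (hall z) z1 z2 b2 hby
  have hO : ∀ w', ¬ Src C S v x w' → w' ≠ y3 → w' = o → ∀ f, ∃ κ, ∀ b, cls b ≠ κ → cls b ≠ ng κ →
      ∀ y, In C (fun q => S q ∨ q = x ∨ q = u) u w2 (upd f w' b) y := by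
    rintro w' hs hy3 rfl f
    obtain ⟨κ, hκ⟩ := h.i1 f
    obtain ⟨κ1, κ2, hap, hr⟩ := M1 (C.s y3 x) (C.s x u) (cls (f y3)) κ
    obtain ⟨κ', hκ'⟩ := M3 κ1 κ2 hap
    refine ⟨tw n κ', fun b b1 b2 y => ?_⟩
    obtain ⟨β, c1, c2, c3, c4⟩ := hκ' (tw n (cls b)) (tw_ne b1)
      (tw_ne (by rw [tw_ng]; exact b2)) (C.s u w2) (cls y)
    refine comp1 _ κ β y (fun z hz => (hκ z hz).congr h.hv fun q hq => ?_) ?_ ?_ c4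
    · exact upd_ne _ _ _ _ (by rintro rfl; exact hs hq)
    · rw [upd_ne _ _ _ _ hy3.symm]; exact hr β c1 c2
    · rw [upd_same]; exact c3
  refine ⟨by tauto, ?_, hAuw, ?_, ?_, ?_⟩
  · rintro (h1 | h1 | h1)
    · exact hSw h1
    · exact hu.ne h1.symm
    · exact hw2u h1
  · intro f
    obtain ⟨κ, hκ⟩ := h.i1 f
    obtain ⟨κ1, κ2, hap, hr⟩ := M1 (C.s y3 x) (C.s x u) (cls (f y3)) κ
    obtain ⟨κ', hκ'⟩ := M2 κ1 κ2 hap (C.s u w2) (tw n (cls (f o)))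
    refine ⟨κ', fun y hy => ?_⟩
    obtain ⟨β, c1, c2, c3, c4⟩ := hκ' _ hy
    exact comp1 f κ β y hκ (hr β c1 c2) c3 c4
  · rintro w' ⟨hw', q, hq, hqw⟩ f
    by_cases hs : Src C S v x w'
    · obtain ⟨κ1, κ2, hk⟩ := h.i2R w' hs f
      exact ⟨κ1, κ2, fun b b1 b2 y => compA _ y (hk b b1 b2)⟩
    by_cases hy3 : w' = y3
    · subst hy3
      obtain ⟨κ, hκ⟩ := h.i1 f
      obtain ⟨κ1, κ2, hr⟩ := M1g (C.s w' x) κ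
      refine ⟨κ1, κ2, fun b b1 b2 y => ?_⟩
      obtain ⟨κ0, h0⟩ := hr (cls b) b1 b2 (C.s x u)
      obtain ⟨β, c1, c2, c3⟩ := FC (C.s u w2) κ0 (tw n (cls (upd f w' b o))) (cls y)
      refine comp1 _ κ β y (fun z hz => (hκ z hz).congr h.hv fun q hq => ?_) ?_ c2 c3
      · exact upd_ne _ _ _ _ (by rintro rfl; exact hs hq)
      · rw [upd_same]; exact h0 β c1
    · have : w' = o := by
        rcases hq with hq | rfl | rfl
        · refine absurd ⟨by tauto, q, hq, ?_⟩ hs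
          rcases hqw with ⟨e, -⟩ | e
          · exact Or.inl ⟨e, by tauto⟩
          · exact Or.inr e
        · rcases hqw with ⟨e, -⟩ | ⟨m, e⟩
          · rcases (hx.nb w').1 e with rfl | rfl | rfl
            · exact absurd (Or.inl h.hv) hw'
            · tauto
            · tauto
          · exact absurd e (hx.tcs _ _)
        · rcases hqw with ⟨e, e'⟩ | ⟨m, e⟩
          · rcases (hu.nb w').1 e with rfl | rfl <;> tauto
          · exact ((hu.tcs _ _).1 e).1
      obtain ⟨κ, hk⟩ := hO w' hs hy3 this f
      exact ⟨κ, ng κ, hk⟩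
  · rintro w' ⟨hw', q, hq, hqw⟩ hU hex f
    by_cases hs : Src C S v x w'
    · obtain ⟨κ, hk⟩ := h.i2T w' hs hU (fun p hp hA => by
        obtain ⟨rfl, -⟩ := hex p (Or.inl hp) hA
        exact absurd hp hSu) f
      exact ⟨κ, fun b b1 b2 y => compA _ y (hk b b1 b2)⟩
    have hy3 : w' ≠ y3 := by
      rintro rfl
      exact hxu (hex x (by tauto) ((hx.nb _).2 (by tauto))).1
    refine hO w' hs hy3 ?_ f
    rcases hq with hq | rfl | rfl
    · refine absurd ⟨by tauto, q, hq, ?_⟩ hs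
      rcases hqw with ⟨e, -⟩ | e
      · exact Or.inl ⟨e, by tauto⟩
      · exact Or.inr e
    · rcases hqw with ⟨e, -⟩ | ⟨m, e⟩
      · exact absurd (hex _ (by tauto) e).1 hxu
      · exact absurd e (hx.tcs _ _)
    · rcases hqw with ⟨e, e'⟩ | ⟨m, e⟩
      · rcases (hu.nb w').1 e with rfl | rfl <;> tauto
      · exact ((hu.tcs _ _).1 e).1

end K6M

/-! ### Seeds -/

namespace K6M

variable {B : Type*} {C : Ctx B}

lemma UN.A1 {v n o a b} (h : UN C v n o a b) : C.A v a := (h.nb a).2 (Or.inl rfl)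
lemma UN.A2 {v n o a b} (h : UN C v n o a b) : C.A v b := (h.nb b).2 (Or.inr rfl)
lemma UN.tc {v n o a b} (h : UN C v n o a b) : C.tc v o n := (h.tcs o n).2 ⟨rfl, rfl⟩
lemma UN.ao {v n o a b} (h : UN C v n o a b) : o ≠ v := by
  rintro rfl; exact C.tc_irr _ _ h.tc
lemma UN.av {v n o a b} (h : UN C v n o a b) : a ≠ v := by
  rintro rfl; exact C.A_irr _ h.A1
lemma UN.bv {v n o a b} (h : UN C v n o a b) : b ≠ v := by
  rintro rfl; exact C.A_irr _ h.A2

/-- Two adjacent `U`-vertices do not share their `2`-neighbour. -/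
lemma seed1_ne (hI : Irr C) {p u op ou q w : B} {np nu : Bool} (hp : UN C p np op u q)
    (hu : UN C u nu ou p w) : op ≠ u ∧ ou ≠ p := by
  have main : op = u → False := by
    rintro rfl
    obtain ⟨rfl, rfl⟩ := (hu.tcs _ _).1 (C.tc_symm hp.tc)
    apply hI (fun x => x = p ∨ x = op) ⟨p, _, Or.inl rfl, hp.A1⟩
    intro f
    obtain ⟨a, b, h1, h2, h3, h4⟩ := FS1 (C.s q p) (C.s w op) (C.s p op) np (f q) (f w)
    have hpo := hu.av
    obtain ⟨g, e1, e2, e3⟩ : ∃ g : B → Col, g p = a ∧ g op = b ∧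
      ∀ q, q ≠ p → q ≠ op → g q = f q :=
      ⟨upd (upd f p a) op b, by rw [upd_ne _ _ _ _ hpo, upd_same], upd_same _ _ _,
        fun q q1 q2 => by rw [upd_ne _ _ _ _ q2, upd_ne _ _ _ _ q1]⟩
    refine ⟨g, fun x hx => e3 x (by tauto) (by tauto), ?_⟩
    rintro x (rfl | rfl)
    · refine ⟨fun y hy => ?_, fun y m hy => ?_⟩
      · rcases (hp.nb y).1 hy with rfl | rfl
        · rw [e1, e2]; exact h3
        · rw [e1, e3 _ hp.bv hp.ne.symm]; exact ok_symm' C h1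
      · obtain ⟨rfl, rfl⟩ := (hp.tcs _ _).1 hy
        rw [e1, e2]; exact tc_symm' h4
    · refine ⟨fun y hy => ?_, fun y m hy => ?_⟩
      · rcases (hu.nb y).1 hy with rfl | rfl
        · rw [e1, e2]; exact ok_symm' C h3
        · rw [e2, e3 _ hu.ne.symm hu.bv]; exact ok_symm' C h2
      · obtain ⟨rfl, rfl⟩ := (hu.tcs _ _).1 hy
        rw [e1, e2]; exact h4
  refine ⟨main, ?_⟩
  rintro rfl
  exact main ((hp.tcs _ _).1 (C.tc_symm hu.tc)).1.symm

lemma SEED1 (hI : Irr C) {p u op ou q w : B} {np nu : Bool} (hp : UN C p np op u q)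
    (hu : UN C u nu ou p w) : Inv C (fun x => x = p ∨ x = u) u w := by
  obtain ⟨hopu, houp⟩ := seed1_ne hI hp hu
  have hpu := hu.av
  have comp : ∀ (f : B → Col) (β : Cls) (y : Col),
      reach (C.s q p) (C.s p u) (cls (f q)) (tw np (cls (f op))) β = true →
      β ≠ tw nu (cls (f ou)) → adj (C.s u w) β (cls y) = true →
      In C (fun x => x = p ∨ x = u) u w f y := by
    intro f β y hr hb ha
    obtain ⟨b, rfl, hby⟩ := CL _ _ _ ha
    obtain ⟨a, z1, z2, z3⟩ := M1x _ _ _ _ _ hr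
    obtain ⟨g, e1, e2, e3⟩ : ∃ g : B → Col, g p = a ∧ g u = b ∧
      ∀ q, q ≠ p → q ≠ u → g q = f q :=
      ⟨upd (upd f p a) u b, by rw [upd_ne _ _ _ _ hpu, upd_same], upd_same _ _ _,
        fun q q1 q2 => by rw [upd_ne _ _ _ _ q2, upd_ne _ _ _ _ q1]⟩
    refine ⟨g, fun x hx => e3 x (by tauto) (by tauto), ?_, by rw [e2]; exact hby⟩
    rintro x (rfl | rfl)
    · refine ⟨fun y hy _ => ?_, fun y m hy => ?_⟩
      · rcases (hp.nb y).1 hy with rfl | rfl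
        · rw [e1, e2]; exact z3
        · rw [e1, e3 _ hp.bv hp.ne.symm]; exact ok_symm' C z1
      · obtain ⟨rfl, rfl⟩ := (hp.tcs _ _).1 hy
        rw [e1, e3 _ hp.ao hopu]; exact z2
    · refine ⟨fun y hy hn => ?_, fun y m hy => ?_⟩
      · rcases (hu.nb y).1 hy with rfl | rfl
        · rw [e1, e2]; exact ok_symm' C z3
        · tauto
      · obtain ⟨rfl, rfl⟩ := (hu.tcs _ _).1 hy
        rw [e2, e3 _ houp hu.ao]; exact hb
  have hO : ∀ w', w' ≠ q → w' ≠ op → w' = ou → ∀ f, ∃ κ, ∀ b, cls b ≠ κ → cls b ≠ ng κ →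
      ∀ y, In C (fun x => x = p ∨ x = u) u w (upd f w' b) y := by
    rintro w' hq hop rfl f
    obtain ⟨κ1, κ2, hap, hr⟩ := M1 (C.s q p) (C.s p u) (cls (f q)) (tw np (cls (f op)))
    obtain ⟨κ', hκ'⟩ := M3 κ1 κ2 hap
    refine ⟨tw nu κ', fun b b1 b2 y => ?_⟩
    obtain ⟨β, c1, c2, c3, c4⟩ := hκ' (tw nu (cls b)) (tw_ne b1)
      (tw_ne (by rw [tw_ng]; exact b2)) (C.s u w) (cls y)
    refine comp _ β y ?_ ?_ c4
    · rw [upd_ne _ _ _ _ hq.symm, upd_ne _ _ _ _ hop.symm]; exact hr β c1 c2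
    · rw [upd_same]; exact c3
  have hsrc : ∀ w', Src C (fun x => x = p ∨ x = u) u w w' → w' = q ∨ w' = op ∨ w' = ou := by
    rintro w' ⟨hw', x, rfl | rfl, ⟨hA, hn⟩ | ⟨m, ht⟩⟩
    · rcases (hp.nb _).1 hA with rfl | rfl <;> tauto
    · exact Or.inr (Or.inl ((hp.tcs _ _).1 ht).1)
    · rcases (hu.nb _).1 hA with rfl | rfl <;> tauto
    · exact Or.inr (Or.inr ((hu.tcs _ _).1 ht).1)
  refine ⟨by tauto, ?_, hu.A2, ?_, ?_, ?_⟩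
  · rintro (h | h)
    · exact hu.ne h.symm
    · exact hu.bv h
  · intro f
    obtain ⟨κ1, κ2, hap, hr⟩ := M1 (C.s q p) (C.s p u) (cls (f q)) (tw np (cls (f op)))
    obtain ⟨κ', hκ'⟩ := M2 κ1 κ2 hap (C.s u w) (tw nu (cls (f ou)))
    refine ⟨κ', fun y hy => ?_⟩
    obtain ⟨β, c1, c2, c3, c4⟩ := hκ' _ hy
    exact comp f β y (hr β c1 c2) c3 c4
  · intro w' hs f
    have fin : ∀ f' : B → Col, (∃ κ0, ∀ m, m ≠ κ0 →
        reach (C.s q p) (C.s p u) (cls (f' q)) (tw np (cls (f' op))) m = true) →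
        ∀ y, In C (fun x => x = p ∨ x = u) u w f' y := by
      rintro f' ⟨κ0, h0⟩ y
      obtain ⟨β, c1, c2, c3⟩ := FC (C.s u w) κ0 (tw nu (cls (f' ou))) (cls y)
      exact comp _ β y (h0 β c1) c2 c3
    by_cases hq : w' = q
    · subst hq
      by_cases hop : op = w'
      · refine ⟨0, 0, fun b _ _ => fin _ ?_⟩
        rw [hop]
        exact M1g' _ _ _ _
      · obtain ⟨κ1, κ2, hr⟩ := M1g (C.s w' p) (tw np (cls (f op)))
        refine ⟨κ1, κ2, fun b b1 b2 => fin _ ?_⟩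
        rw [upd_same, upd_ne _ _ _ _ hop]
        exact hr _ b1 b2 _
    by_cases hop : w' = op
    · subst hop
      obtain ⟨κ1, κ2, hr⟩ := M1t (C.s q p) (C.s p u) (cls (f q))
      refine ⟨tw np κ1, tw np κ2, fun b b1 b2 => fin _ ?_⟩
      rw [upd_same, upd_ne _ _ _ _ (Ne.symm hq)]
      exact hr _ (tw_ne b1) (tw_ne b2)
    · obtain ⟨κ, hk⟩ := hO w' hq hop (by have := hsrc w' hs; tauto) f
      exact ⟨κ, ng κ, hk⟩
  · intro w' hs hU hex f
    have hq : w' ≠ q := by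
      rintro rfl
      exact hpu (hex p (by tauto) hp.A2).1
    by_cases hop : w' = op
    · subst hop
      have hou : ou ≠ w' := by
        rintro rfl
        obtain ⟨m, o, a, b, hU⟩ := hU
        have h1 := ((hU.tcs _ _).1 (C.tc_symm hp.tc)).1
        have h2 := ((hU.tcs _ _).1 (C.tc_symm hu.tc)).1
        exact hpu (h1.trans h2.symm)
      obtain ⟨κ', hk⟩ := G1 (C.s q p) (C.s p u) (cls (f q)) (tw nu (cls (f ou)))
      refine ⟨tw np κ', fun b b1 _ y => ?_⟩
      obtain ⟨β, c1, c2, c3⟩ := hk _ (tw_ne b1) (C.s u w) (cls y)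
      refine comp _ β y ?_ ?_ c3
      · rw [upd_same, upd_ne _ _ _ _ hq.symm]; exact c1
      · rw [upd_ne _ _ _ _ hou]; exact c2
    · exact hO w' hq hop (by have := hsrc w' hs; tauto) f

/-- Two `U`-neighbours of an `X`-vertex are not adjacent. -/
lemma X3_nadj (hI : Irr C) {x p p' u : B} (hx : XN C x p p' u) (hp : IsU C p) (hp' : IsU C p') :
    ¬ C.A p p' := by
  intro hA
  have hpx : C.A p x := C.A_symm ((hx.nb p).2 (by tauto))
  have hpx' : C.A p' x := C.A_symm ((hx.nb p').2 (by tauto))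
  have hxp' : x ≠ p' := by rintro rfl; exact C.A_irr _ hpx'
  have hxp : x ≠ p := by rintro rfl; exact C.A_irr _ hpx
  obtain ⟨n, o, b, h⟩ := hp.of_adj hA
  obtain rfl : x = b := ((h.nb x).1 hpx).resolve_left hxp'
  obtain ⟨n', o', b', h'⟩ := hp'.of_adj (C.A_symm hA)
  obtain rfl : x = b' := ((h'.nb x).1 hpx').resolve_left hxp
  exact closeX hI (SEED1 hI h h') hx.swap' (Or.inl rfl)

/-- Two `U`-neighbours of an `X`-vertex with three `U`-neighbours do not share a `2`-neighbour. -/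
lemma X3_tne (hI : Irr C) {x p p' u op op' ou q q' w : B} {np np' nu : Bool}
    (hx : XN C x p p' u) (hp : UN C p np op x q) (hp' : UN C p' np' op' x q')
    (hu : UN C u nu ou x w) : op ≠ p' := by
  rintro rfl
  have hpp' : ¬ C.A p op := X3_nadj hI hx ⟨_, _, _, _, hp⟩ ⟨_, _, _, _, hp'⟩
  have hpu : ¬ C.A p u := X3_nadj hI hx.swap ⟨_, _, _, _, hp⟩ ⟨_, _, _, _, hu⟩
  have hp'u : ¬ C.A op u := X3_nadj hI hx.swap'.swap ⟨_, _, _, _, hp'⟩ ⟨_, _, _, _, hu⟩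
  obtain ⟨rfl, rfl⟩ := (hp'.tcs _ _).1 (C.tc_symm hp.tc)
  apply hI (fun y => y = p ∨ y = op ∨ y = x ∨ y = u) ⟨p, _, Or.inl rfl, hp.A1⟩
  intro f
  obtain ⟨κ3, κ4, hap, hM⟩ := M1 (C.s w u) (C.s u x) (cls (f w)) (tw nu (cls (f ou)))
  obtain ⟨β, b1, z, z1, z2, z3, z4⟩ := FS3 (C.s q p) (C.s p x) (C.s q' op) (C.s x op) np
    (cls (f q)) (cls (f q')) κ3 κ4 hap
  obtain ⟨b, rfl, hb⟩ := CR _ _ _ b1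
  obtain ⟨c, rfl, hc⟩ := CL _ _ _ z4
  obtain ⟨a, a1, a2, a3⟩ := M1x _ _ _ _ _ z3
  obtain ⟨d, d1, d2, d3⟩ := M1x _ _ _ _ _ (hM _ z1 z2)
  have n1 : p ≠ op := hx.hab
  have n2 := hx.hac
  have n3 := hx.hbc
  have n4 := hp.av
  have n5 := hp'.av
  have n6 := hu.av
  obtain ⟨g, e1, e2, e3, e4, e5⟩ : ∃ g : B → Col, g p = a ∧ g op = b ∧ g x = c ∧ g u = d ∧
      ∀ q, q ≠ p → q ≠ op → q ≠ x → q ≠ u → g q = f q := by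
    classical
    refine ⟨fun q => if q = p then a else if q = op then b else if q = x then c else
      if q = u then d else f q, ?_, ?_, ?_, ?_, ?_⟩
    · simp
    · simp [n1.symm]
    · simp [n4, n5]
    · simp [n2.symm, n3.symm, n6.symm]
    · intro q h1 h2 h3 h4; simp [h1, h2, h3, h4]
  refine ⟨g, fun y hy => e5 y (by tauto) (by tauto) (by tauto) (by tauto), ?_⟩
  rintro y (rfl | rfl | rfl | rfl)
  · refine ⟨fun r hr => ?_, fun r m hr => ?_⟩
    · rcases (hp.nb r).1 hr with rfl | rfl
      · rw [e1, e3]; exact a3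
      · rw [e1, e5 r hp.bv (by rintro rfl; exact hpp' hr) hp.ne.symm (by rintro rfl; exact hpu hr)]
        exact ok_symm' C a1
    · obtain ⟨rfl, rfl⟩ := (hp.tcs _ _).1 hr
      rw [e1, e2]; exact a2
  · refine ⟨fun r hr => ?_, fun r m hr => ?_⟩
    · rcases (hp'.nb r).1 hr with rfl | rfl
      · rw [e2, e3]; exact ok_symm' C hc
      · rw [e2, e5 r (by rintro rfl; exact hpp' (C.A_symm hr)) hp'.bv hp'.ne.symm
          (by rintro rfl; exact hp'u hr)]
        exact ok_symm' C hb
    · obtain ⟨rfl, rfl⟩ := (hp'.tcs _ _).1 hr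
      rw [e1, e2]; exact tc_symm' a2
  · refine ⟨fun r hr => ?_, fun r m hr => absurd hr (hx.tcs _ _)⟩
    rcases (hx.nb r).1 hr with rfl | rfl | rfl
    · rw [e1, e3]; exact ok_symm' C a3
    · rw [e2, e3]; exact hc
    · rw [e3, e4]; exact ok_symm' C d3
  · refine ⟨fun r hr => ?_, fun r m hr => ?_⟩
    · rcases (hu.nb r).1 hr with rfl | rfl
      · rw [e4, e3]; exact d3
      · rw [e4, e5 r (by rintro rfl; exact hpu (C.A_symm hr))
          (by rintro rfl; exact hp'u (C.A_symm hr)) hu.ne.symm hu.bv]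
        exact ok_symm' C d1
    · obtain ⟨rfl, rfl⟩ := (hu.tcs _ _).1 hr
      rw [e4, e5 r (by rintro rfl; exact n3.symm ((hp.tcs _ _).1 (C.tc_symm hr)).1)
        (by rintro rfl; exact n2.symm ((hp'.tcs _ _).1 (C.tc_symm hr)).1)
        (by rintro rfl; exact hx.tcs _ _ (C.tc_symm hr)) hu.ao]
      exact d2

end K6M

/-! ### The second seed and strong darts -/

namespace K6M

variable {B : Type*} {C : Ctx B}

lemma IsU.tc_unique {v a b : B} {m n : Bool} (h : IsU C v) (ha : C.tc a v m) (hb : C.tc b v n) :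
    a = b := by
  obtain ⟨_, _, _, _, h⟩ := h
  exact ((h.tcs _ _).1 (C.tc_symm ha)).1.trans ((h.tcs _ _).1 (C.tc_symm hb)).1.symm

section
variable {x p p' u op op' ou q q' w : B} {np np' nu : Bool}

lemma seed2_comp (hI : Irr C)
    (hx : XN C x p p' u) (hp : UN C p np op x q) (hp' : UN C p' np' op' x q')
    (hu : UN C u nu ou x w) (f : B → Col) (z β : Cls) (y : Col)
    (hr : reach (C.s q p) (C.s p x) (cls (f q)) (tw np (cls (f op))) z = true)
    (hr' : reach (C.s q' p') (C.s p' x) (cls (f q')) (tw np' (cls (f op'))) z = true)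
    (hz : adj (C.s x u) z β = true) (hb : β ≠ tw nu (cls (f ou)))
    (ha : adj (C.s u w) β (cls y) = true) :
    In C (fun y => y = p ∨ y = p' ∨ y = x ∨ y = u) u w f y := by
  have Up : IsU C p := ⟨_, _, _, _, hp⟩
  have Up' : IsU C p' := ⟨_, _, _, _, hp'⟩
  have Uu : IsU C u := ⟨_, _, _, _, hu⟩
  have hpp' : ¬ C.A p p' := X3_nadj hI hx Up Up'
  have hpu : ¬ C.A p u := X3_nadj hI hx.swap Up Uu
  have hp'u : ¬ C.A p' u := X3_nadj hI hx.swap'.swap Up' Uu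
  have t1 : op ≠ p' := X3_tne hI hx hp hp' hu
  have t2 : op ≠ u := X3_tne hI hx.swap hp hu hp'
  have t3 : op' ≠ p := X3_tne hI hx.swap' hp' hp hu
  have t4 : op' ≠ u := X3_tne hI hx.swap'.swap hp' hu hp
  have t5 : ou ≠ p := X3_tne hI hx.swap.swap' hu hp hp'
  have t6 : ou ≠ p' := X3_tne hI hx.swap'.swap.swap' hu hp' hp
  obtain ⟨d, rfl, hd⟩ := CL _ _ _ ha
  obtain ⟨c, rfl, hc⟩ := CL _ _ _ hz
  obtain ⟨a, a1, a2, a3⟩ := M1x _ _ _ _ _ hr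
  obtain ⟨b, b1, b2, b3⟩ := M1x _ _ _ _ _ hr'
  clear hr hr'
  have n1 : p ≠ p' := hx.hab
  have n2 := hx.hac
  have n3 := hx.hbc
  have n4 := hp.av
  have n5 := hp'.av
  have n6 := hu.av
  obtain ⟨g, e1, e2, e3, e4, e5⟩ : ∃ g : B → Col, g p = a ∧ g p' = b ∧ g x = c ∧ g u = d ∧
      ∀ q, q ≠ p → q ≠ p' → q ≠ x → q ≠ u → g q = f q := by
    classical
    refine ⟨fun q => if q = p then a else if q = p' then b else if q = x then c else
      if q = u then d else f q, ?_, ?_, ?_, ?_, ?_⟩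
    · simp
    · simp [n1.symm]
    · simp [n4, n5]
    · simp [n2.symm, n3.symm, n6.symm]
    · intro q h1 h2 h3 h4; simp [h1, h2, h3, h4]
  refine ⟨g, fun y hy => e5 y (by tauto) (by tauto) (by tauto) (by tauto), ?_, by rw [e4]; exact hd⟩
  rintro y (rfl | rfl | rfl | rfl)
  · refine ⟨fun r hr _ => ?_, fun r m hr => ?_⟩
    · rcases (hp.nb r).1 hr with rfl | rfl
      · rw [e1, e3]; exact a3
      · rw [e1, e5 r hp.bv (by rintro rfl; exact hpp' hr) hp.ne.symm (by rintro rfl; exact hpu hr)]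
        exact ok_symm' C a1
    · obtain ⟨rfl, rfl⟩ := (hp.tcs _ _).1 hr
      rw [e1, e5 r hp.ao t1 (by rintro rfl; exact hx.tcs _ _ (C.tc_symm hr)) t2]; exact a2
  · refine ⟨fun r hr _ => ?_, fun r m hr => ?_⟩
    · rcases (hp'.nb r).1 hr with rfl | rfl
      · rw [e2, e3]; exact b3
      · rw [e2, e5 r (by rintro rfl; exact hpp' (C.A_symm hr)) hp'.bv hp'.ne.symm
          (by rintro rfl; exact hp'u hr)]
        exact ok_symm' C b1
    · obtain ⟨rfl, rfl⟩ := (hp'.tcs _ _).1 hr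
      rw [e2, e5 r t3 hp'.ao (by rintro rfl; exact hx.tcs _ _ (C.tc_symm hr)) t4]; exact b2
  · refine ⟨fun r hr _ => ?_, fun r m hr => absurd hr (hx.tcs _ _)⟩
    rcases (hx.nb r).1 hr with rfl | rfl | rfl
    · rw [e1, e3]; exact ok_symm' C a3
    · rw [e2, e3]; exact ok_symm' C b3
    · rw [e3, e4]; exact hc
  · refine ⟨fun r hr hn => ?_, fun r m hr => ?_⟩
    · rcases (hu.nb r).1 hr with rfl | rfl
      · rw [e4, e3]; exact ok_symm' C hc
      · tauto
    · obtain ⟨rfl, rfl⟩ := (hu.tcs _ _).1 hr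
      rw [e4, e5 r t5 t6 (by rintro rfl; exact hx.tcs _ _ (C.tc_symm hr)) hu.ao]
      exact hb

/-- The part of the second seed which is used for both neighbours. -/
lemma seed2_p (hI : Irr C)
    (hx : XN C x p p' u) (hp : UN C p np op x q) (hp' : UN C p' np' op' x q')
    (hu : UN C u nu ou x w) (w' : B) (hw : w' = q ∨ w' = op) (f : B → Col) :
    ∃ κ1 κ2, ∀ b, cls b ≠ κ1 → cls b ≠ κ2 →
    ∀ y, In C (fun y => y = p ∨ y = p' ∨ y = x ∨ y = u) u w (upd f w' b) y := by
  have fin : ∀ f' : B → Col, (∃ κ0, ∀ m, m ≠ κ0 →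
      reach (C.s q p) (C.s p x) (cls (f' q)) (tw np (cls (f' op))) m = true) →
      ∀ y, In C (fun y => y = p ∨ y = p' ∨ y = x ∨ y = u) u w f' y := by
    rintro f' ⟨κ0, h0⟩ y
    obtain ⟨κ3, κ4, hap, hr⟩ := M1 (C.s q' p') (C.s p' x) (cls (f' q')) (tw np' (cls (f' op')))
    obtain ⟨κ', hκ'⟩ := M5 κ3 κ4 hap κ0 (C.s x u)
    obtain ⟨β, c1, c2, c3⟩ := FC (C.s u w) κ' (tw nu (cls (f' ou))) (cls y)
    obtain ⟨z, z1, z2, z3, z4⟩ := hκ' β c1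
    exact seed2_comp hI hx hp hp' hu f' z β y (h0 z z1) (hr z z2 z3) z4 c2 c3
  by_cases hq : w' = q
  · subst hq
    by_cases hop : op = w'
    · refine ⟨0, 0, fun b _ _ => fin _ ?_⟩
      rw [hop]
      exact M1g' _ _ _ _
    · obtain ⟨κ1, κ2, hr⟩ := M1g (C.s w' p) (tw np (cls (f op)))
      refine ⟨κ1, κ2, fun b b1 b2 => fin _ ?_⟩
      rw [upd_same, upd_ne _ _ _ _ hop]
      exact hr _ b1 b2 _
  · obtain rfl := hw.resolve_left hq
    obtain ⟨κ1, κ2, hr⟩ := M1t (C.s q p) (C.s p x) (cls (f q))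
    refine ⟨tw np κ1, tw np κ2, fun b b1 b2 => fin _ ?_⟩
    rw [upd_same, upd_ne _ _ _ _ (Ne.symm hq)]
    exact hr _ (tw_ne b1) (tw_ne b2)

lemma seed2_t (hI : Irr C)
    (hx : XN C x p p' u) (hp : UN C p np op x q) (hp' : UN C p' np' op' x q')
    (hu : UN C u nu ou x w) (hU : IsU C op) (h1 : op ≠ q) (h2 : op ≠ q') (f : B → Col) :
    ∃ κ, ∀ b, cls b ≠ κ → cls b ≠ ng κ →
    ∀ y, In C (fun y => y = p ∨ y = p' ∨ y = x ∨ y = u) u w (upd f op b) y := by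
  have h3 : op' ≠ op := by rintro rfl; exact hx.hab (hU.tc_unique hp.tc hp'.tc)
  have h4 : ou ≠ op := by rintro rfl; exact hx.hac (hU.tc_unique hp.tc hu.tc)
  obtain ⟨κ3, κ4, hap, hr⟩ := M1 (C.s q' p') (C.s p' x) (cls (f q')) (tw np' (cls (f op')))
  obtain ⟨κ', hk⟩ := G2 (C.s q p) (C.s p x) (cls (f q)) κ3 κ4 hap
  refine ⟨tw np κ', fun b b1 _ y => ?_⟩
  obtain ⟨κ'', hk'⟩ := hk _ (tw_ne b1) (C.s x u)
  obtain ⟨β, c1, c2, c3⟩ := FC (C.s u w) κ'' (tw nu (cls (f ou))) (cls y)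
  obtain ⟨z, z1, z2, z3, z4⟩ := hk' β c1
  refine seed2_comp hI hx hp hp' hu _ z β y ?_ ?_ z4 ?_ c3
  · rw [upd_same, upd_ne _ _ _ _ h1.symm]; exact z1
  · rw [upd_ne _ _ _ _ h2.symm, upd_ne _ _ _ _ h3]; exact hr z z2 z3
  · rw [upd_ne _ _ _ _ h4]; exact c2

lemma SEED2 (hI : Irr C)
    (hx : XN C x p p' u) (hp : UN C p np op x q) (hp' : UN C p' np' op' x q')
    (hu : UN C u nu ou x w) : Inv C (fun y => y = p ∨ y = p' ∨ y = x ∨ y = u) u w := by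
  have Up : IsU C p := ⟨_, _, _, _, hp⟩
  have Up' : IsU C p' := ⟨_, _, _, _, hp'⟩
  have Uu : IsU C u := ⟨_, _, _, _, hu⟩
  have hpu : ¬ C.A p u := X3_nadj hI hx.swap Up Uu
  have hp'u : ¬ C.A p' u := X3_nadj hI hx.swap'.swap Up' Uu
  have hSeq : (fun y => y = p' ∨ y = p ∨ y = x ∨ y = u) =
      (fun y => y = p ∨ y = p' ∨ y = x ∨ y = u) := by
    funext y; simp only [eq_iff_iff]; tauto
  have hO : ∀ w', w' ≠ q → w' ≠ op → w' ≠ q' → w' ≠ op' → w' = ou → ∀ f, ∃ κ, ∀ b, cls b ≠ κ →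
      cls b ≠ ng κ →
      ∀ y, In C (fun y => y = p ∨ y = p' ∨ y = x ∨ y = u) u w (upd f w' b) y := by
    rintro w' hq hop hq' hop' rfl f
    obtain ⟨κ1, κ2, hap, hr⟩ := M1 (C.s q p) (C.s p x) (cls (f q)) (tw np (cls (f op)))
    obtain ⟨κ3, κ4, hap', hr'⟩ := M1 (C.s q' p') (C.s p' x) (cls (f q')) (tw np' (cls (f op')))
    obtain ⟨κ5, κ6, hap5, h5⟩ := M4 κ1 κ2 hap κ3 κ4 hap' (C.s x u)
    obtain ⟨κ', hκ'⟩ := M3 κ5 κ6 hap5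
    refine ⟨tw nu κ', fun b b1 b2 y => ?_⟩
    obtain ⟨β, c1, c2, c3, c4⟩ := hκ' (tw nu (cls b)) (tw_ne b1)
      (tw_ne (by rw [tw_ng]; exact b2)) (C.s u w) (cls y)
    obtain ⟨z, z1, z2, z3, z4, z5⟩ := h5 β c1 c2
    refine seed2_comp hI hx hp hp' hu _ z β y ?_ ?_ z5 ?_ c4
    · rw [upd_ne _ _ _ _ hq.symm, upd_ne _ _ _ _ hop.symm]; exact hr z z1 z2
    · rw [upd_ne _ _ _ _ hq'.symm, upd_ne _ _ _ _ hop'.symm]; exact hr' z z3 z4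
    · rw [upd_same]; exact c3
  have hsrc : ∀ w', Src C (fun y => y = p ∨ y = p' ∨ y = x ∨ y = u) u w w' →
      w' = q ∨ w' = op ∨ w' = q' ∨ w' = op' ∨ w' = ou := by
    rintro w' ⟨hw', y, hy, h⟩
    rcases hy with rfl | rfl | rfl | rfl
    · rcases h with ⟨hA, hn⟩ | ⟨m, ht⟩
      · rcases (hp.nb _).1 hA with rfl | rfl <;> tauto
      · have := ((hp.tcs _ _).1 ht).1; tauto
    · rcases h with ⟨hA, hn⟩ | ⟨m, ht⟩
      · rcases (hp'.nb _).1 hA with rfl | rfl <;> tauto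
      · have := ((hp'.tcs _ _).1 ht).1; tauto
    · rcases h with ⟨hA, hn⟩ | ⟨m, ht⟩
      · rcases (hx.nb _).1 hA with rfl | rfl | rfl <;> tauto
      · exact absurd ht (hx.tcs _ _)
    · rcases h with ⟨hA, hn⟩ | ⟨m, ht⟩
      · rcases (hu.nb _).1 hA with rfl | rfl <;> tauto
      · have := ((hu.tcs _ _).1 ht).1; tauto
  refine ⟨by tauto, ?_, hu.A2, ?_, ?_, ?_⟩
  · rintro (h | h | h | h)
    · subst h; exact hpu (C.A_symm hu.A2)
    · subst h; exact hp'u (C.A_symm hu.A2)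
    · exact hu.ne h.symm
    · exact hu.bv h
  · intro f
    obtain ⟨κ1, κ2, hap, hr⟩ := M1 (C.s q p) (C.s p x) (cls (f q)) (tw np (cls (f op)))
    obtain ⟨κ3, κ4, hap', hr'⟩ := M1 (C.s q' p') (C.s p' x) (cls (f q')) (tw np' (cls (f op')))
    obtain ⟨κ5, κ6, hap5, h5⟩ := M4 κ1 κ2 hap κ3 κ4 hap' (C.s x u)
    obtain ⟨κ', hκ'⟩ := M2 κ5 κ6 hap5 (C.s u w) (tw nu (cls (f ou)))
    refine ⟨κ', fun y hy => ?_⟩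
    obtain ⟨β, c1, c2, c3, c4⟩ := hκ' _ hy
    obtain ⟨z, z1, z2, z3, z4, z5⟩ := h5 β c1 c2
    exact seed2_comp hI hx hp hp' hu f z β y (hr z z1 z2) (hr' z z3 z4) z5 c3 c4
  · intro w' hs f
    by_cases h1 : w' = q ∨ w' = op
    · exact seed2_p hI hx hp hp' hu w' h1 f
    by_cases h2 : w' = q' ∨ w' = op'
    · have := seed2_p hI hx.swap' hp' hp hu w' h2 f
      rwa [hSeq] at this
    push Not at h1 h2
    obtain ⟨κ, hk⟩ := hO w' h1.1 h1.2 h2.1 h2.2 (by have := hsrc w' hs; tauto) f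
    exact ⟨κ, ng κ, hk⟩
  · intro w' hs hU hex f
    have hq : w' ≠ q := by
      rintro rfl
      exact hx.hac (hex p (by tauto) hp.A2).1
    have hq' : w' ≠ q' := by
      rintro rfl
      exact hx.hbc (hex p' (by tauto) hp'.A2).1
    by_cases hop : w' = op
    · subst hop
      exact seed2_t hI hx hp hp' hu hU hq hq' f
    by_cases hop' : w' = op'
    · subst hop'
      have := seed2_t hI hx.swap' hp' hp hu hU hq' hq f
      rwa [hSeq] at this
    exact hO w' hq hop hq' hop' (by have := hsrc w' hs; tauto) f

end

/-- Strong darts. -/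
inductive Strong (C : Ctx B) : B → B → Prop
  | s1 {v n o z w} : UN C v n o z w → IsU C z → Strong C v w
  | s2 {v n o z w p p'} : UN C v n o z w → XN C z v p p' → IsU C p → IsU C p' → Strong C v w
  | s3 {v n o z w u y} : UN C v n o z w → XN C z v u y → IsU C u → Strong C u z → Strong C v w

lemma Strong.inv (hI : Irr C) {v w : B} (h : Strong C v w) : ∃ S, Inv C S v w := by
  induction h with
  | s1 hv hz =>
    obtain ⟨n, o, b, hz⟩ := hz.of_adj (C.A_symm hv.A1)
    exact ⟨_, SEED1 hI hz hv⟩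
  | s2 hv hx hp hp' =>
    obtain ⟨n, o, b, hp⟩ := hp.of_adj (C.A_symm ((hx.nb _).2 (Or.inr (Or.inl rfl))))
    obtain ⟨n', o', b', hp'⟩ := hp'.of_adj (C.A_symm ((hx.nb _).2 (Or.inr (Or.inr rfl))))
    exact ⟨_, SEED2 hI hx.swap'.swap hp hp' hv⟩
  | s3 hv hx hu _ ih =>
    obtain ⟨S, hS⟩ := ih
    exact ⟨_, STEP hI hS hx.swap' hv⟩

/-- final closure at a `U`-vertex -/
lemma fin1 (hI : Irr C) {S : B → Prop} {v w ow w2 : B} {nw : Bool} (h : Inv C S v w)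
    (hw : UN C w nw ow v w2) : False := by
  apply hI (fun q => S q ∨ q = w) ⟨w, _, Or.inr rfl, hw.A1⟩
  intro f
  obtain ⟨b, hb1, hb2, hb3⟩ : ∃ b, (S w2 ∨ ok (C.s w2 w) (f w2) b = true) ∧
      (S ow ∨ cls b ≠ tw nw (cls (f ow))) ∧ In C S v w (upd f w b) b := by
    by_cases h2 : S w2
    · obtain ⟨κ1, κ2, hk⟩ := h.i2R w ⟨h.hw, w2, h2, Or.inl ⟨C.A_symm hw.A2,
        fun e => hw.ne e.1.symm⟩⟩ f
      obtain ⟨m, e1, e2, e3, -, -⟩ := P5 κ1 κ2 (tw nw (cls (f ow))) κ1 κ1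
      obtain ⟨b, rfl⟩ := cls_surj m
      exact ⟨b, Or.inl h2, Or.inr e3, hk b e1 e2 b⟩
    by_cases ho : S ow
    · obtain ⟨κ1, κ2, hk⟩ := h.i2R w ⟨h.hw, ow, ho, Or.inr ⟨_, C.tc_symm hw.tc⟩⟩ f
      obtain ⟨m, hm, e1, e2⟩ := FA (C.s w2 w) (cls (f w2)) κ1 κ2
      obtain ⟨b, rfl, hb⟩ := CR _ _ _ hm
      exact ⟨b, Or.inr hb, Or.inl ho, hk b e1 e2 b⟩
    · obtain ⟨κ, hk⟩ := h.i1 f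
      obtain ⟨m, hm, e1, e2⟩ := FA (C.s w2 w) (cls (f w2)) κ (tw nw (cls (f ow)))
      obtain ⟨b, rfl, hb⟩ := CR _ _ _ hm
      refine ⟨b, Or.inr hb, Or.inr e2, (hk b e1).congr h.hv ?_⟩
      rintro q ⟨hq, p, hp, hpq⟩
      refine upd_ne _ _ _ _ ?_
      rintro rfl
      rcases hpq with ⟨hA, hn⟩ | ⟨m, ht⟩
      · rcases (hw.nb p).1 (C.A_symm hA) with rfl | rfl
        · tauto
        · exact h2 hp
      · obtain ⟨rfl, -⟩ := (hw.tcs _ _).1 (C.tc_symm ht)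
        exact ho hp
  obtain ⟨g, h1, h2, h3⟩ := hb3
  have hgw : g w = b := by rw [h1 w h.hw, upd_same]
  have key : ∀ q, S q → ∀ y, C.A q y → ok (C.s q y) (g q) (g y) = true := by
    intro q hq y hy
    by_cases he : q = v ∧ y = w
    · obtain ⟨rfl, rfl⟩ := he; rw [hgw]; exact h3
    · exact (h2 q hq).1 y hy he
  refine ⟨g, fun q hq => ?_, fun q hq => ?_⟩
  · rw [h1 q (by tauto), upd_ne _ _ _ _ (by tauto)]
  rcases hq with hq | rfl
  · exact ⟨key q hq, (h2 q hq).2⟩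
  · refine ⟨fun y hy => ?_, fun y n hy => ?_⟩
    · by_cases hS : S y
      · exact ok_symm' C (key y hS q (C.A_symm hy))
      · rcases (hw.nb y).1 hy with rfl | rfl
        · exact absurd h.hv hS
        · rw [hgw, h1 y hS, upd_ne _ _ _ _ hw.bv]
          exact ok_symm' C (hb1.resolve_left hS)
    · by_cases hS : S y
      · exact tc_symm' ((h2 y hS).2 q _ (C.tc_symm hy))
      · obtain ⟨rfl, rfl⟩ := (hw.tcs _ _).1 hy
        rw [hgw, h1 y hS, upd_ne _ _ _ _ hw.ao]
        exact hb2.resolve_left hS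

/-- final closure at an `X`-vertex with three `U`-neighbours -/
lemma fin2 (hI : Irr C) {S : B → Prop} {x v p p' op op' q q' ov wv : B} {np np' nv : Bool}
    (h : Inv C S v x)
    (hx : XN C x p p' v) (hp : UN C p np op x q) (hp' : UN C p' np' op' x q')
    (hv : UN C v nv ov x wv) : False := by
  have Up : IsU C p := ⟨_, _, _, _, hp⟩
  have Up' : IsU C p' := ⟨_, _, _, _, hp'⟩
  have hx1 : XN C x v p p' := hx.swap.swap'
  have hpp' : ¬ C.A p p' := X3_nadj hI hx Up Up'
  have t1 : op ≠ p' := X3_tne hI hx hp hp' hv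
  have t3 : op' ≠ p := X3_tne hI hx.swap' hp' hp hv
  have Sp : ¬ S p := fun hb => closeX hI h hx1 hb
  have Sp' : ¬ S p' := fun hb => closeX hI h hx1.swap hb
  have So : ¬ S op := fun hb => closeU hI h hx1 hp (Or.inl hb)
  have Sq : ¬ S q := fun hb => closeU hI h hx1 hp (Or.inr hb)
  have So' : ¬ S op' := fun hb => closeU hI h hx1.swap hp' (Or.inl hb)
  have Sq' : ¬ S q' := fun hb => closeU hI h hx1.swap hp' (Or.inr hb)
  have n1 : p ≠ p' := hx.hab
  have n4 := hp.av
  have n5 := hp'.av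
  apply hI (fun y => S y ∨ y = p ∨ y = p' ∨ y = x) ⟨p, _, by tauto, hp.A1⟩
  intro f
  obtain ⟨κ, hκ⟩ := h.i1 f
  obtain ⟨κ1, κ2, -, hr⟩ := M1 (C.s q p) (C.s p x) (cls (f q)) (tw np (cls (f op)))
  obtain ⟨κ3, κ4, -, hr'⟩ := M1 (C.s q' p') (C.s p' x) (cls (f q')) (tw np' (cls (f op')))
  obtain ⟨m, m0, m1, m2, m3, m4⟩ := P5 κ κ1 κ2 κ3 κ4
  obtain ⟨c, rfl⟩ := cls_surj m
  obtain ⟨g0, h1, h2, h3⟩ := hκ c m0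
  obtain ⟨a, a1, a2, a3⟩ := M1x _ _ _ _ _ (hr _ m1 m2)
  obtain ⟨b, b1, b2, b3⟩ := M1x _ _ _ _ _ (hr' _ m3 m4)
  clear hr hr'
  obtain ⟨g, e1, e2, e3, e5⟩ : ∃ g : B → Col, g p = a ∧ g p' = b ∧ g x = c ∧
      ∀ q, q ≠ p → q ≠ p' → q ≠ x → g q = g0 q := by
    classical
    refine ⟨fun q => if q = p then a else if q = p' then b else if q = x then c else g0 q,
      ?_, ?_, ?_, ?_⟩
    · simp
    · simp [n1.symm]
    · simp [n4, n5]
    · intro q h1 h2 h3; simp [h1, h2, h3]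
  have k1 : ∀ y, S y → g y = g0 y := by
    intro y hy
    exact e5 y (by rintro rfl; exact Sp hy) (by rintro rfl; exact Sp' hy)
      (by rintro rfl; exact h.hw hy)
  have keyA : ∀ y, S y → ∀ r, C.A y r → ok (C.s y r) (g y) (g r) = true := by
    intro y hy r hA
    rw [k1 y hy]
    by_cases hrx : r = x
    · subst hrx
      have : y = v := by
        rcases (hx.nb y).1 (C.A_symm hA) with rfl | rfl | rfl
        · exact absurd hy Sp
        · exact absurd hy Sp'
        · rfl
      subst this
      rw [e3]; exact h3
    · have hrp : r ≠ p := by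
        rintro rfl
        rcases (hp.nb y).1 (C.A_symm hA) with rfl | rfl
        · exact h.hw hy
        · exact Sq hy
      have hrp' : r ≠ p' := by
        rintro rfl
        rcases (hp'.nb y).1 (C.A_symm hA) with rfl | rfl
        · exact h.hw hy
        · exact Sq' hy
      rw [e5 r hrp hrp' hrx]
      exact (h2 y hy).1 r hA (by tauto)
  refine ⟨g, fun y hy => by rw [e5 y (by tauto) (by tauto) (by tauto), h1 y (by tauto)], ?_⟩
  rintro y (hy | rfl | rfl | rfl)
  · refine ⟨keyA y hy, fun r m hr => ?_⟩
    have hrx : r ≠ x := by rintro rfl; exact hx.tcs _ _ (C.tc_symm hr)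
    have hrp : r ≠ p := by
      rintro rfl
      obtain ⟨rfl, -⟩ := (hp.tcs _ _).1 (C.tc_symm hr)
      exact So hy
    have hrp' : r ≠ p' := by
      rintro rfl
      obtain ⟨rfl, -⟩ := (hp'.tcs _ _).1 (C.tc_symm hr)
      exact So' hy
    rw [k1 y hy, e5 r hrp hrp' hrx]
    exact (h2 y hy).2 r m hr
  · refine ⟨fun r hr => ?_, fun r m hr => ?_⟩
    · rcases (hp.nb r).1 hr with rfl | rfl
      · rw [e1, e3]; exact a3
      · rw [e1, e5 r hp.bv (by rintro rfl; exact hpp' hr) hp.ne.symm, h1 r Sq]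
        exact ok_symm' C a1
    · obtain ⟨rfl, rfl⟩ := (hp.tcs _ _).1 hr
      rw [e1, e5 r hp.ao t1 (by rintro rfl; exact hx.tcs _ _ (C.tc_symm hr)), h1 r So]; exact a2
  · refine ⟨fun r hr => ?_, fun r m hr => ?_⟩
    · rcases (hp'.nb r).1 hr with rfl | rfl
      · rw [e2, e3]; exact b3
      · rw [e2, e5 r (by rintro rfl; exact hpp' (C.A_symm hr)) hp'.bv hp'.ne.symm, h1 r Sq']
        exact ok_symm' C b1
    · obtain ⟨rfl, rfl⟩ := (hp'.tcs _ _).1 hr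
      rw [e2, e5 r t3 hp'.ao (by rintro rfl; exact hx.tcs _ _ (C.tc_symm hr)), h1 r So']; exact b2
  · refine ⟨fun r hr => ?_, fun r m hr => absurd hr (hx.tcs _ _)⟩
    rcases (hx.nb r).1 hr with rfl | rfl | rfl
    · rw [e1, e3]; exact ok_symm' C a3
    · rw [e2, e3]; exact ok_symm' C b3
    · exact ok_symm' C (keyA _ h.hv _ (C.A_symm hr))

lemma FIN (hI : Irr C) {v z : B} (h : Strong C v z) :
    ∀ (S : B → Prop) (w : B), C.A v w → w ≠ z → Inv C S v w → False := by
  induction h with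
  | @s1 v n o x z hv hz =>
    intro S w hA hne hS
    obtain rfl : w = x := ((hv.nb _).1 hA).resolve_right hne
    obtain ⟨n, o, b, hz⟩ := hz.of_adj (C.A_symm hv.A1)
    exact fin1 hI hS hz
  | @s2 v n o x z p p' hv hx hp hp' =>
    intro S w hA hne hS
    obtain rfl : w = x := ((hv.nb _).1 hA).resolve_right hne
    obtain ⟨n, o, b, hp⟩ := hp.of_adj (C.A_symm ((hx.nb _).2 (Or.inr (Or.inl rfl))))
    obtain ⟨n', o', b', hp'⟩ := hp'.of_adj (C.A_symm ((hx.nb _).2 (Or.inr (Or.inr rfl))))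
    exact fin2 hI hS hx.swap'.swap hp hp' hv
  | @s3 v n o x z u y hv hx hu _ ih =>
    intro S w hA hne hS
    obtain rfl : w = x := ((hv.nb _).1 hA).resolve_right hne
    obtain ⟨n, o, b, hu⟩ := hu.of_adj (C.A_symm ((hx.nb _).2 (Or.inr (Or.inl rfl))))
    exact ih _ b hu.A2 hu.ne.symm (STEP hI hS hx hu)

lemma no_both (hI : Irr C) {v a b : B} (hab : a ≠ b) (ha : Strong C v a) (hb : Strong C v b) :
    False := by
  obtain ⟨S, hS⟩ := ha.inv hI
  exact FIN hI hb S a hS.hA hab hS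

end K6M

/-! ### From graphs to constraint systems -/

namespace K6M

variable {V : Type*} (G : SimpleGraph V) (s : V → V → Bool)

def TN (t u o : V) : Prop := u ≠ o ∧ ∀ y, G.Adj t y ↔ y = u ∨ y = o
def Is2 (t : V) : Prop := ∃ u o, TN G t u o

def GRed (S : V → Prop) : Prop :=
  ∀ f : V → Col, ∃ g : V → Col, (∀ x, ¬ S x → g x = f x) ∧
    ∀ x, S x → ∀ y, G.Adj x y → ok (s x y) (g x) (g y) = true

variable {G s}

lemma TN.symm {t u o} (h : TN G t u o) : TN G t o u :=
  ⟨h.1.symm, fun y => by rw [h.2]; tauto⟩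

lemma TN.adj1 {t u o} (h : TN G t u o) : G.Adj t u := (h.2 u).2 (Or.inl rfl)
lemma TN.adj2 {t u o} (h : TN G t u o) : G.Adj t o := (h.2 o).2 (Or.inr rfl)

lemma TN.unique {t u o o'} (h : TN G t u o) (h' : TN G t u o') : o = o' := by
  rcases (h'.2 o).1 h.adj2 with e | e
  · exact absurd e.symm h.1
  · exact e

lemma Is2.of_adj {t u} (h : Is2 G t) (hu : G.Adj t u) : ∃ o, TN G t u o := by
  obtain ⟨a, b, h⟩ := h
  rcases (h.2 u).1 hu with rfl | rfl
  · exact ⟨_, h⟩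
  · exact ⟨_, h.symm⟩

variable (G s) in
def ctxG (hs : ∀ x y, s x y = s y x) : Ctx V where
  A x y := G.Adj x y ∧ ¬ Is2 G x ∧ ¬ Is2 G y
  s := s
  tc x y n := ∃ t, TN G t x y ∧ n = (s x t ^^ s t y)
  A_symm := fun h => ⟨h.1.symm, h.2.2, h.2.1⟩
  A_irr := fun a h => G.irrefl h.1
  s_symm := hs
  tc_symm := by
    rintro a b n ⟨t, ht, rfl⟩
    exact ⟨t, ht.symm, by rw [hs a t, hs t b, Bool.xor_comm]⟩
  tc_irr := by
    rintro a n ⟨t, ht, -⟩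
    exact ht.1 rfl

section

lemma no_leaf (hs : ∀ x y, s x y = s y x)
    (hG : ∀ S : V → Prop, (∃ x, S x) → ¬ GRed G s S) (v u : V) (h : ∀ y, G.Adj v y → y = u) : False := by
  apply hG (fun x => x = v) ⟨v, rfl⟩
  intro f
  obtain ⟨m, hm, -, -⟩ := FA (s u v) (cls (f u)) 0 0
  obtain ⟨b, -, hb⟩ := CR _ _ _ hm
  refine ⟨upd f v b, fun x hx => upd_ne _ _ _ _ hx, ?_⟩
  rintro x rfl y hy
  have hne : y ≠ x := fun e => G.irrefl (e ▸ hy)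
  rw [upd_same, upd_ne _ _ _ _ hne]
  obtain rfl := h y hy
  rw [hs, ok_symm]; exact hb

lemma no_22 (hs : ∀ x y, s x y = s y x)
    (hG : ∀ S : V → Prop, (∃ x, S x) → ¬ GRed G s S) {t u : V} (ht : Is2 G t) (hu : Is2 G u) (hA : G.Adj t u) : False := by
  obtain ⟨o, ht⟩ := ht.of_adj hA
  obtain ⟨r, hu⟩ := hu.of_adj hA.symm
  apply hG (fun x => x = t ∨ x = u) ⟨t, Or.inl rfl⟩
  intro f
  obtain ⟨m, hm, hm1, -⟩ := FA (s r u) (cls (f r)) (tw (s o t ^^ s t u) (cls (f o))) 0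
  obtain ⟨b, rfl, hb⟩ := CR _ _ _ hm
  obtain ⟨a, a1, a2⟩ := TT _ _ _ _ hm1
  have ntu : t ≠ u := fun e => G.irrefl (e ▸ hA)
  have not' : o ≠ t := fun e => G.irrefl (e ▸ ht.adj2)
  have nru : r ≠ u := fun e => G.irrefl (e ▸ hu.adj2)
  refine ⟨upd (upd f t a) u b, fun x hx => ?_, ?_⟩
  · rw [upd_ne _ _ _ _ (by tauto), upd_ne _ _ _ _ (by tauto)]
  rintro x (rfl | rfl) y hy
  · rw [upd_ne _ _ _ _ ntu, upd_same]
    rcases (ht.2 y).1 hy with rfl | rfl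
    · rw [upd_same]; exact a2
    · rw [upd_ne _ _ _ _ ht.1.symm, upd_ne _ _ _ _ not', hs, ok_symm]; exact a1
  · rw [upd_same]
    rcases (hu.2 y).1 hy with rfl | rfl
    · rw [upd_ne _ _ _ _ ntu, upd_same, hs, ok_symm]; exact a2
    · rw [upd_ne _ _ _ _ nru, upd_ne _ _ _ _ hu.1.symm, hs, ok_symm]; exact hb

lemma redB (hs : ∀ x y, s x y = s y x)
    (hG : ∀ S : V → Prop, (∃ x, S x) → ¬ GRed G s S) (S : V → Prop) (hS : ∃ x, S x ∧ ¬ Is2 G x) : ¬ Red (ctxG G s hs) S := by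
  intro hR
  obtain ⟨x0, hx0, hb0⟩ := hS
  apply hG (fun q => (S q ∧ ¬ Is2 G q) ∨ (Is2 G q ∧ ∃ x, S x ∧ ¬ Is2 G x ∧ G.Adj q x))
    ⟨x0, Or.inl ⟨hx0, hb0⟩⟩
  intro f
  obtain ⟨g, h1, h2⟩ := hR f
  have key : ∀ t : V, ∃ z : Col, (Is2 G t ∧ ∃ x, S x ∧ ¬ Is2 G x ∧ G.Adj t x) →
      ∀ w, G.Adj t w → ok (s t w) z (g w) = true := by
    intro t
    by_cases ht : Is2 G t ∧ ∃ x, S x ∧ ¬ Is2 G x ∧ G.Adj t x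
    · obtain ⟨ht, x, hx, hxb, hA⟩ := ht
      obtain ⟨o, hT⟩ := ht.of_adj hA
      have hc := (h2 x hx).2 o _ ⟨t, hT, rfl⟩
      obtain ⟨z, z1, z2⟩ := TT _ _ _ _ (tc_symm' hc)
      refine ⟨z, fun _ w hw => ?_⟩
      rcases (hT.2 w).1 hw with rfl | rfl
      · rw [hs, ok_symm]; exact z1
      · exact z2
    · exact ⟨0, fun h => absurd h ht⟩
  choose z hz using key
  classical
  refine ⟨fun q => if Is2 G q then (if ∃ x, S x ∧ ¬ Is2 G x ∧ G.Adj q x then z q else f q)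
    else g q, ?_, ?_⟩
  · intro q hq
    by_cases h : Is2 G q
    · have h' : ¬ ∃ x, S x ∧ ¬ Is2 G x ∧ G.Adj q x := fun h' => hq (Or.inr ⟨h, h'⟩)
      simp only [if_pos h, if_neg h']
    · simp only [if_neg h]; exact h1 q (fun hS => hq (Or.inl ⟨hS, h⟩))
  · rintro x (⟨hx, hxb⟩ | ⟨hx2, hx⟩) y hy
    · simp only [if_neg hxb]
      by_cases h : Is2 G y
      · have h' : ∃ x, S x ∧ ¬ Is2 G x ∧ G.Adj y x := ⟨x, hx, hxb, hy.symm⟩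
        simp only [if_pos h, if_pos h']
        rw [hs, ok_symm]
        exact hz y ⟨h, h'⟩ x hy.symm
      · simp only [if_neg h]
        exact (h2 x hx).1 y ⟨hy, hxb, h⟩
    · have hyb : ¬ Is2 G y := fun h => no_22 hs hG hx2 h hy
      simp only [if_pos hx2, if_pos hx, if_neg hyb]
      exact hz x ⟨hx2, hx⟩ y hy

lemma irrG (hs : ∀ x y, s x y = s y x)
    (hG : ∀ S : V → Prop, (∃ x, S x) → ¬ GRed G s S) : Irr (ctxG G s hs) := by
  rintro S ⟨x, y, hx, hA⟩
  exact redB hs hG S ⟨x, hx, hA.2.1⟩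

/-- a vertex with at most one big neighbour and two `2`-neighbours -/
lemma red12 (hs : ∀ x y, s x y = s y x)
    (hG : ∀ S : V → Prop, (∃ x, S x) → ¬ GRed G s S) {w a o1 o2 : V} {n1 n2 : Bool} (hw : ¬ Is2 G w)
    (hA : ∀ y, (ctxG G s hs).A w y → y = a)
    (hT : ∀ y m, (ctxG G s hs).tc w y m → (y = o1 ∧ m = n1) ∨ (y = o2 ∧ m = n2)) : False := by
  apply redB hs hG (fun x => x = w) ⟨w, rfl, hw⟩
  intro f
  obtain ⟨m, hm, m1, m2⟩ := FA (s a w) (cls (f a)) (tw n1 (cls (f o1))) (tw n2 (cls (f o2)))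
  obtain ⟨b, rfl, hb⟩ := CR _ _ _ hm
  refine ⟨upd f w b, fun x hx => upd_ne _ _ _ _ hx, ?_⟩
  rintro x rfl
  refine ⟨fun y hy => ?_, fun y m hy => ?_⟩
  · have hne : y ≠ x := fun e => G.irrefl (e ▸ hy.1)
    rw [upd_same, upd_ne _ _ _ _ hne]
    obtain rfl := hA y hy
    exact ok_symm' (ctxG G s hs) hb
  · have hne : y ≠ x := by rintro rfl; exact (ctxG G s hs).tc_irr _ _ hy
    rw [upd_same, upd_ne _ _ _ _ hne]
    rcases hT y m hy with ⟨rfl, rfl⟩ | ⟨rfl, rfl⟩ <;> assumption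

/-- a vertex with no big neighbour and four `2`-neighbours -/
lemma red04 (hs : ∀ x y, s x y = s y x)
    (hG : ∀ S : V → Prop, (∃ x, S x) → ¬ GRed G s S) {w o1 o2 o3 o4 : V} {n1 n2 n3 n4 : Bool} (hw : ¬ Is2 G w)
    (hA : ∀ y, ¬ (ctxG G s hs).A w y)
    (hT : ∀ y m, (ctxG G s hs).tc w y m → (y = o1 ∧ m = n1) ∨ (y = o2 ∧ m = n2) ∨
      (y = o3 ∧ m = n3) ∨ (y = o4 ∧ m = n4)) : False := by
  apply redB hs hG (fun x => x = w) ⟨w, rfl, hw⟩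
  intro f
  obtain ⟨m, m1, m2, m3, m4, -⟩ := P5 (tw n1 (cls (f o1))) (tw n2 (cls (f o2)))
    (tw n3 (cls (f o3))) (tw n4 (cls (f o4))) 0
  obtain ⟨b, rfl⟩ := cls_surj m
  refine ⟨upd f w b, fun x hx => upd_ne _ _ _ _ hx, ?_⟩
  rintro x rfl
  refine ⟨fun y hy => absurd hy (hA y), fun y m hy => ?_⟩
  have hne : y ≠ x := by rintro rfl; exact (ctxG G s hs).tc_irr _ _ hy
  rw [upd_same, upd_ne _ _ _ _ hne]
  rcases hT y m hy with ⟨rfl, rfl⟩ | ⟨rfl, rfl⟩ | ⟨rfl, rfl⟩ | ⟨rfl, rfl⟩ <;> assumption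

end
end K6M

/-! ### A vertex with three `2`-neighbours -/

namespace K6M

section
variable {B : Type*} {C : Ctx B}

lemma aux13 (hI : Irr C) {v w ov q : B} {nv : Bool} (hA : ∀ y, C.A w y → y = v)
    (hv : UN C v nv ov w q)
    (hc : ∀ f : B → Col, ∃ a b, ok (C.s q v) (f q) a = true ∧ ok (C.s v w) a b = true ∧
      (ov = w → cls a ≠ tw nv (cls b)) ∧ (ov ≠ w → cls a ≠ tw nv (cls (f ov))) ∧
      ∀ y m, C.tc w y m → y ≠ v → cls b ≠ tw m (cls (f y))) : False := by
  have hvw : C.A v w := (hv.nb w).2 (Or.inl rfl)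
  have hvq : C.A v q := (hv.nb q).2 (Or.inr rfl)
  have nvw : v ≠ w := by rintro rfl; exact C.A_irr _ hvw
  have nqv : q ≠ v := by rintro rfl; exact C.A_irr _ hvq
  have nqw : q ≠ w := hv.ne.symm
  have nov : ov ≠ v := by
    rintro rfl; exact C.tc_irr _ nv ((hv.tcs _ _).2 ⟨rfl, rfl⟩)
  apply hI (fun x => x = v ∨ x = w) ⟨v, w, Or.inl rfl, hvw⟩
  intro f
  obtain ⟨a, b, h1, h2, h3, h4, h5⟩ := hc f
  refine ⟨upd (upd f v a) w b, fun x hx => ?_, ?_⟩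
  · rw [upd_ne _ _ _ _ (fun e => hx (Or.inr e)), upd_ne _ _ _ _ (fun e => hx (Or.inl e))]
  have gv : upd (upd f v a) w b v = a := by rw [upd_ne _ _ _ _ nvw, upd_same]
  have gw : upd (upd f v a) w b w = b := upd_same _ _ _
  have go : ∀ y, y ≠ v → y ≠ w → upd (upd f v a) w b y = f y := fun y y1 y2 => by
    rw [upd_ne _ _ _ _ y2, upd_ne _ _ _ _ y1]
  have tv : ∀ y m, C.tc v y m → cls a ≠ tw m (cls (upd (upd f v a) w b y)) := by
    intro y m hy
    obtain ⟨rfl, rfl⟩ := (hv.tcs y m).1 hy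
    by_cases e : y = w
    · have := h3 e
      subst e; rw [gw]; exact this
    · rw [go y nov e]; exact h4 e
  rintro x (rfl | rfl)
  · refine ⟨fun y hy => ?_, fun y m hy => ?_⟩
    · rw [gv]
      rcases (hv.nb y).1 hy with rfl | rfl
      · rw [gw]; exact h2
      · rw [go _ nqv nqw]; exact ok_symm' C h1
    · rw [gv]; exact tv y m hy
  · refine ⟨fun y hy => ?_, fun y m hy => ?_⟩
    · obtain rfl := hA y hy
      rw [gv, gw]; exact ok_symm' C h2
    · rw [gw]
      have nyx : y ≠ x := by rintro rfl; exact C.tc_irr _ _ hy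
      by_cases e : y = v
      · subst e
        have := tv x m (C.tc_symm hy)
        rw [gw] at this
        rw [gv]
        exact tc_symm' this
      · rw [go y e nyx]; exact h5 y m hy e

lemma red13 (hI : Irr C) {v w o1 o2 o3 : B} {n1 n2 n3 : Bool} (hA : ∀ y, C.A w y → y = v)
    (hvw : C.A v w)
    (hT : ∀ y m, C.tc w y m → (y = o1 ∧ m = n1) ∨ (y = o2 ∧ m = n2) ∨ (y = o3 ∧ m = n3))
    (hU : IsU C v) : False := by
  obtain ⟨nv, ov, q, hv⟩ := hU.of_adj hvw
  by_cases e : ov = w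
  · subst e
    have htv : C.tc ov v nv := C.tc_symm ((hv.tcs _ _).2 ⟨rfl, rfl⟩)
    have : ∃ p1 p2 : B, ∃ k1 k2 : Bool, ∀ y m, C.tc ov y m → y ≠ v →
        (y = p1 ∧ m = k1) ∨ (y = p2 ∧ m = k2) := by
      rcases hT _ _ htv with h | h | h
      · refine ⟨o2, o3, n2, n3, fun y m hy hne => ?_⟩
        rcases hT _ _ hy with h' | h' | h'
        · exact absurd (h'.1.trans h.1.symm) hne
        · exact Or.inl h'
        · exact Or.inr h'
      · refine ⟨o1, o3, n1, n3, fun y m hy hne => ?_⟩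
        rcases hT _ _ hy with h' | h' | h'
        · exact Or.inl h'
        · exact absurd (h'.1.trans h.1.symm) hne
        · exact Or.inr h'
      · refine ⟨o1, o2, n1, n2, fun y m hy hne => ?_⟩
        rcases hT _ _ hy with h' | h' | h'
        · exact Or.inl h'
        · exact Or.inr h'
        · exact absurd (h'.1.trans h.1.symm) hne
    obtain ⟨p1, p2, k1, k2, hp⟩ := this
    refine aux13 hI hA hv fun f => ?_
    obtain ⟨l, hl, z, z1, z2, z3, z4⟩ := FS4 (C.s q v) (C.s v ov) nv (cls (f q))
      (tw k1 (cls (f p1))) (tw k2 (cls (f p2)))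
    obtain ⟨a, rfl, ha⟩ := CR _ _ _ hl
    obtain ⟨b, rfl, hb⟩ := CR _ _ _ z4
    refine ⟨a, b, ha, hb, fun _ => tc_symm' z3, fun h => absurd rfl h, fun y m hy hne => ?_⟩
    rcases hp y m hy hne with ⟨rfl, rfl⟩ | ⟨rfl, rfl⟩ <;> assumption
  · refine aux13 hI hA hv fun f => ?_
    obtain ⟨κ1, κ2, -, hk⟩ := M1 (C.s q v) (C.s v w) (cls (f q)) (tw nv (cls (f ov)))
    obtain ⟨m, m1, m2, m3, m4, m5⟩ := P5 κ1 κ2 (tw n1 (cls (f o1))) (tw n2 (cls (f o2)))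
      (tw n3 (cls (f o3)))
    obtain ⟨b, rfl⟩ := cls_surj m
    obtain ⟨a, a1, a2, a3⟩ := M1x _ _ _ _ _ (hk _ m1 m2)
    refine ⟨a, b, a1, a3, fun h => absurd h e, fun _ => a2, fun y m hy hne => ?_⟩
    rcases hT y m hy with ⟨rfl, rfl⟩ | ⟨rfl, rfl⟩ | ⟨rfl, rfl⟩ <;> assumption

/-! ### Taking -/

open Classical in
noncomputable def take (C : Ctx B) (v w : B) : ℤ :=
  if IsU C v ∧ C.A v w then
    (if Strong C v w then 2 else if ∃ z, z ≠ w ∧ Strong C v z then 0 else 1) else 0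

lemma take_nonneg (v w : B) : 0 ≤ take C v w := by
  unfold take; split_ifs <;> norm_num

lemma take_le (v w : B) : take C v w ≤ 2 := by
  unfold take; split_ifs <;> norm_num

lemma take_not {v w : B} (h : ¬ (IsU C v ∧ C.A v w)) : take C v w = 0 := by
  unfold take; rw [if_neg h]

lemma take_zero (hI : Irr C) {v w z : B} (hz : Strong C v z) (h : z ≠ w) : take C v w = 0 := by
  unfold take
  have h1 : ¬ Strong C v w := fun hs => no_both hI h hz hs
  have h2 : ∃ z, z ≠ w ∧ Strong C v z := ⟨z, h, hz⟩
  rw [if_neg h1, if_pos h2, ite_self]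

lemma take_le_one {v w : B} (h : ¬ Strong C v w) : take C v w ≤ 1 := by
  unfold take; rw [if_neg h]; split_ifs <;> norm_num

lemma Strong.adj {v w : B} (h : Strong C v w) : C.A v w := by
  cases h with
  | s1 h _ => exact (h.nb w).2 (Or.inr rfl)
  | s2 h _ _ _ => exact (h.nb w).2 (Or.inr rfl)
  | s3 h _ _ _ => exact (h.nb w).2 (Or.inr rfl)

lemma take_sum (hI : Irr C) {v o a b : B} {n : Bool} (h : UN C v n o a b) :
    take C v a + take C v b = 2 := by
  have ha : IsU C v ∧ C.A v a := ⟨⟨_, _, _, _, h⟩, (h.nb a).2 (Or.inl rfl)⟩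
  have hb : IsU C v ∧ C.A v b := ⟨⟨_, _, _, _, h⟩, (h.nb b).2 (Or.inr rfl)⟩
  by_cases sa : Strong C v a
  · rw [take_zero hI sa h.ne]; unfold take; rw [if_pos ha, if_pos sa]; rfl
  by_cases sb : Strong C v b
  · rw [take_zero hI sb h.ne.symm]; unfold take; rw [if_pos hb, if_pos sb]; rfl
  have hz : ¬ ∃ z, z ≠ a ∧ Strong C v z := by
    rintro ⟨z, h1, h2⟩
    rcases (h.nb z).1 h2.adj with rfl | rfl
    · exact h1 rfl
    · exact sb h2
  have hz' : ¬ ∃ z, z ≠ b ∧ Strong C v z := by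
    rintro ⟨z, h1, h2⟩
    rcases (h.nb z).1 h2.adj with rfl | rfl
    · exact sa h2
    · exact h1 rfl
  unfold take
  rw [if_pos ha, if_pos hb, if_neg sa, if_neg sb, if_neg hz, if_neg hz']; rfl

/-- a `U`-vertex gives nothing to other `U`-vertices -/
lemma take_UU (hI : Irr C) {v w : B} (hw : IsU C w) (hA : C.A v w) (hv : IsU C v) :
    take C v w = 0 := by
  obtain ⟨n, o, b, h⟩ := hv.of_adj hA
  exact take_zero hI (Strong.s1 h hw) h.ne.symm

/-- an `X`-vertex gives at most `2` -/
lemma take_X (hI : Irr C) {x a b c : B} (hx : XN C x a b c) :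
    take C a x + take C b x + take C c x ≤ 2 := by
  have Aa : C.A a x := C.A_symm ((hx.nb a).2 (by tauto))
  have Ab : C.A b x := C.A_symm ((hx.nb b).2 (by tauto))
  have Ac : C.A c x := C.A_symm ((hx.nb c).2 (by tauto))
  have l3 : ∀ {p q r : B}, XN C x p q r → IsU C p → IsU C q → IsU C r → take C p x = 0 := by
    intro p q r h hp hq hr
    obtain ⟨n, o, b, hu⟩ := hp.of_adj (C.A_symm ((h.nb p).2 (by tauto)))
    exact take_zero hI (Strong.s2 hu h hq hr) hu.ne.symm
  have l2 : ∀ {p q r : B}, XN C x p q r → IsU C p → IsU C q →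
      take C p x + take C q x ≤ 2 := by
    intro p q r h hp hq
    have t1 := take_le (C := C) p x
    have t2 := take_le (C := C) q x
    by_cases sp : Strong C p x
    · obtain ⟨n, o, b, hu⟩ := hq.of_adj (C.A_symm ((h.nb q).2 (by tauto)))
      have := take_zero hI (Strong.s3 hu h.swap' hp sp) hu.ne.symm
      omega
    by_cases sq : Strong C q x
    · obtain ⟨n, o, b, hu⟩ := hp.of_adj (C.A_symm ((h.nb p).2 (by tauto)))
      have := take_zero hI (Strong.s3 hu h hq sq) hu.ne.symm
      omega
    have := take_le_one sp
    have := take_le_one sq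
    omega
  have t1 := take_le (C := C) a x
  have t2 := take_le (C := C) b x
  have t3 := take_le (C := C) c x
  have z : ∀ {p}, ¬ IsU C p → take C p x = 0 := fun h => take_not (fun e => h e.1)
  by_cases ha : IsU C a <;> by_cases hb : IsU C b <;> by_cases hc : IsU C c
  · rw [l3 hx ha hb hc, l3 hx.swap' hb ha hc, l3 hx.swap.swap' hc ha hb]; norm_num
  · rw [z hc]; have := l2 hx ha hb; omega
  · rw [z hb]; have := l2 hx.swap ha hc; omega
  · rw [z hb, z hc]; omega
  · rw [z ha]; have := l2 hx.swap'.swap hb hc; omega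
  · rw [z ha, z hc]; omega
  · rw [z ha, z hb]; omega
  · rw [z ha, z hb, z hc]; omega

end
end K6M

/-! ### Discharging -/

namespace K6M

section
open Classical

variable {V : Type*} [Fintype V] {G : SimpleGraph V} {s : V → V → Bool}

noncomputable def NT (G : SimpleGraph V) (v : V) : Finset V :=
  Finset.univ.filter fun w => G.Adj v w ∧ Is2 G w
noncomputable def NB (G : SimpleGraph V) (v : V) : Finset V :=
  Finset.univ.filter fun w => G.Adj v w ∧ ¬ Is2 G w

lemma mem_NT {v w : V} : w ∈ NT G v ↔ G.Adj v w ∧ Is2 G w := by simp [NT]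
lemma mem_NB {v w : V} : w ∈ NB G v ↔ G.Adj v w ∧ ¬ Is2 G w := by simp [NB]

lemma deg_eq (v : V) : G.degree v = (NT G v).card + (NB G v).card := by
  rw [← G.card_neighborFinset_eq_degree, NT, NB,
    ← Finset.card_union_of_disjoint]
  · congr 1; ext w; simp; tauto
  · rw [Finset.disjoint_left]; intro w; simp; tauto

lemma is2_of_deg {v : V} (h : G.degree v = 2) : Is2 G v := by
  rw [← G.card_neighborFinset_eq_degree, Finset.card_eq_two] at h
  obtain ⟨a, b, hab, h⟩ := h
  refine ⟨a, b, hab, fun y => ?_⟩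
  rw [← G.mem_neighborFinset, h]; simp

lemma deg_of_is2 {v : V} (h : Is2 G v) : G.degree v = 2 := by
  obtain ⟨a, b, hab, h⟩ := h
  rw [← G.card_neighborFinset_eq_degree, Finset.card_eq_two]
  refine ⟨a, b, hab, ?_⟩
  ext y; rw [G.mem_neighborFinset, h]; simp

lemma deg_ge (hs : ∀ x y, s x y = s y x) (hG : ∀ S : V → Prop, (∃ x, S x) → ¬ GRed G s S)
    {v : V} (hv : ¬ Is2 G v) : 3 ≤ G.degree v := by
  by_contra hlt
  have h2 : G.degree v ≠ 2 := fun h => hv (is2_of_deg h)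
  have h1 : (G.neighborFinset v).card ≤ 1 := by
    rw [G.card_neighborFinset_eq_degree]; omega
  rw [Finset.card_le_one_iff] at h1
  by_cases he : ∃ u, G.Adj v u
  · obtain ⟨u, hu⟩ := he
    refine no_leaf hs hG v u fun y hy => h1 ?_ ?_
    · simpa using hy
    · simpa using hu
  · exact no_leaf hs hG v v fun y hy => absurd ⟨y, hy⟩ he

lemma tc_NT (hs : ∀ x y, s x y = s y x) (v : V) : ∃ (o : V → V) (n : V → Bool),
    ∀ y m, (ctxG G s hs).tc v y m ↔ ∃ t ∈ NT G v, y = o t ∧ m = n t := by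
  have : ∀ t, ∃ o, t ∈ NT G v → TN G t v o := by
    intro t
    by_cases ht : t ∈ NT G v
    · obtain ⟨h1, h2⟩ := mem_NT.1 ht
      obtain ⟨o, ho⟩ := h2.of_adj h1.symm
      exact ⟨o, fun _ => ho⟩
    · exact ⟨v, fun h => absurd h ht⟩
  choose o ho using this
  refine ⟨o, fun t => (s v t ^^ s t (o t)), fun y m => ⟨?_, ?_⟩⟩
  · rintro ⟨t, ht, rfl⟩
    have hm : t ∈ NT G v := mem_NT.2 ⟨ht.adj1.symm, ⟨_, _, ht⟩⟩
    obtain rfl := ht.unique (ho t hm)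
    exact ⟨t, hm, rfl, rfl⟩
  · rintro ⟨t, ht, rfl, rfl⟩
    exact ⟨t, ho t ht, rfl⟩

lemma A_NB (hs : ∀ x y, s x y = s y x) {v : V} (hv : ¬ Is2 G v) (y : V) :
    (ctxG G s hs).A v y ↔ y ∈ NB G v := by
  rw [mem_NB]; exact ⟨fun h => ⟨h.1, h.2.2⟩, fun h => ⟨h.1, hv, h.2⟩⟩

lemma take_in (hs : ∀ x y, s x y = s y x) {v : V} (hv : ¬ Is2 G v) :
    ∑ w, take (ctxG G s hs) w v = ∑ w ∈ NB G v, take (ctxG G s hs) w v := by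
  symm
  apply Finset.sum_subset (Finset.subset_univ _)
  intro w _ hw
  apply take_not
  rintro ⟨-, h⟩
  exact hw ((A_NB hs hv w).1 ((ctxG G s hs).A_symm h))

lemma big_charge (hs : ∀ x y, s x y = s y x)
    (hG : ∀ S : V → Prop, (∃ x, S x) → ¬ GRed G s S) {v : V} (hv : ¬ Is2 G v) :
    28 + 4 * ((NT G v).card : ℤ) + ∑ w ∈ NB G v, take (ctxG G s hs) w v ≤
      10 * (G.degree v : ℤ) + ∑ w, take (ctxG G s hs) v w := by
  have hI := irrG hs hG
  have hd := deg_ge hs hG hv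
  rw [deg_eq] at hd ⊢
  obtain ⟨o, n, hT⟩ := tc_NT (G := G) hs v
  have hA := A_NB (G := G) hs hv
  have hA' : ∀ y, y ∈ NB G v → (ctxG G s hs).A y v := fun y hy =>
    (ctxG G s hs).A_symm ((hA y).2 hy)
  have hout : 0 ≤ ∑ w, take (ctxG G s hs) v w := Finset.sum_nonneg fun w _ => take_nonneg _ _
  have hin : ∑ w ∈ NB G v, take (ctxG G s hs) w v ≤ 2 * ((NB G v).card : ℤ) := by
    have := Finset.sum_le_card_nsmul (NB G v) (fun w => take (ctxG G s hs) w v) 2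
      (fun w _ => take_le _ _)
    simpa [mul_comm] using this
  by_cases hgen : 28 ≤ 8 * (NB G v).card + 6 * (NT G v).card
  · push_cast; omega
  have cases' : ((NB G v).card = 0 ∧ (NT G v).card = 3) ∨
      ((NB G v).card = 0 ∧ (NT G v).card = 4) ∨
      ((NB G v).card = 1 ∧ (NT G v).card = 2) ∨ ((NB G v).card = 1 ∧ (NT G v).card = 3) ∨
      ((NB G v).card = 2 ∧ (NT G v).card = 1) ∨ ((NB G v).card = 3 ∧ (NT G v).card = 0) := by
    omega
  rcases cases' with ⟨hb, ht⟩ | ⟨hb, ht⟩ | ⟨hb, ht⟩ | ⟨hb, ht⟩ | ⟨hb, ht⟩ | ⟨hb, ht⟩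
  · exfalso
    rw [Finset.card_eq_zero] at hb
    obtain ⟨a, b, c, -, -, -, ht⟩ := Finset.card_eq_three.1 ht
    refine red04 hs hG (o1 := o a) (o2 := o b) (o3 := o c) (o4 := o c) (n1 := n a) (n2 := n b)
      (n3 := n c) (n4 := n c) hv (fun y hy => ?_) (fun y m hy => ?_)
    · rw [hA, hb] at hy; simp at hy
    · obtain ⟨t, h1, rfl, rfl⟩ := (hT y m).1 hy
      rw [ht] at h1
      simp only [Finset.mem_insert, Finset.mem_singleton] at h1
      rcases h1 with rfl | rfl | rfl <;> simp
  · exfalso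
    rw [Finset.card_eq_zero] at hb
    obtain ⟨d, T, hd, hT4, hT3⟩ := Finset.card_eq_succ.1 ht
    obtain ⟨a, b, c, -, -, -, rfl⟩ := Finset.card_eq_three.1 hT3
    refine red04 hs hG (o1 := o a) (o2 := o b) (o3 := o c) (o4 := o d) (n1 := n a) (n2 := n b)
      (n3 := n c) (n4 := n d) hv (fun y hy => ?_) (fun y m hy => ?_)
    · rw [hA, hb] at hy; simp at hy
    · obtain ⟨t, h1, rfl, rfl⟩ := (hT y m).1 hy
      rw [← hT4] at h1
      simp only [Finset.mem_insert, Finset.mem_singleton] at h1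
      rcases h1 with rfl | rfl | rfl | rfl <;> simp
  · exfalso
    obtain ⟨a, hb⟩ := Finset.card_eq_one.1 hb
    obtain ⟨b, c, -, ht⟩ := Finset.card_eq_two.1 ht
    refine red12 hs hG (a := a) (o1 := o b) (o2 := o c) (n1 := n b) (n2 := n c) hv
      (fun y hy => ?_) (fun y m hy => ?_)
    · rw [hA, hb] at hy; simpa using hy
    · obtain ⟨t, h1, rfl, rfl⟩ := (hT y m).1 hy
      rw [ht] at h1
      simp only [Finset.mem_insert, Finset.mem_singleton] at h1
      rcases h1 with rfl | rfl <;> simp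
  · obtain ⟨u, hbu⟩ := Finset.card_eq_one.1 hb
    have hAu : (ctxG G s hs).A u v := hA' u (by rw [hbu]; simp)
    obtain ⟨a, b, c, -, -, -, ht'⟩ := Finset.card_eq_three.1 ht
    have hU : ¬ IsU (ctxG G s hs) u := by
      refine fun hU => red13 hI (o1 := o a) (o2 := o b) (o3 := o c) (n1 := n a) (n2 := n b)
        (n3 := n c) (fun y hy => ?_) hAu (fun y m hy => ?_) hU
      · rw [hA, hbu] at hy; simpa using hy
      · obtain ⟨t, h1, rfl, rfl⟩ := (hT y m).1 hy
        rw [ht'] at h1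
        simp only [Finset.mem_insert, Finset.mem_singleton] at h1
        rcases h1 with rfl | rfl | rfl <;> simp
    have : ∑ w ∈ NB G v, take (ctxG G s hs) w v = 0 := by
      rw [hbu, Finset.sum_singleton]; exact take_not fun h => hU h.1
    rw [this, hb, ht]; push_cast; omega
  · obtain ⟨a, b, hab, hbu⟩ := Finset.card_eq_two.1 hb
    obtain ⟨t, ht'⟩ := Finset.card_eq_one.1 ht
    have hU : UN (ctxG G s hs) v (n t) (o t) a b := by
      refine ⟨fun y m => ?_, fun y => ?_, hab⟩
      · rw [hT, ht']; simp
      · rw [hA, hbu]; simp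
    have hin0 : ∑ w ∈ NB G v, take (ctxG G s hs) w v = 0 := by
      apply Finset.sum_eq_zero
      intro w hw
      by_cases hUw : IsU (ctxG G s hs) w
      · exact take_UU hI ⟨_, _, _, _, hU⟩ (hA' w hw) hUw
      · exact take_not fun h => hUw h.1
    have h2 : take (ctxG G s hs) v a + take (ctxG G s hs) v b ≤
        ∑ w, take (ctxG G s hs) v w := by
      rw [← Finset.sum_pair (f := fun w => take (ctxG G s hs) v w) hab]
      exact Finset.sum_le_sum_of_subset_of_nonneg (Finset.subset_univ _)
        fun w _ _ => take_nonneg _ _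
    rw [take_sum hI hU] at h2
    rw [hin0, hb, ht]; push_cast; omega
  · obtain ⟨a, b, c, hab, hac, hbc, hbu⟩ := Finset.card_eq_three.1 hb
    rw [Finset.card_eq_zero] at ht
    have hX : XN (ctxG G s hs) v a b c := by
      refine ⟨fun y m => ?_, fun y => ?_, hab, hac, hbc⟩
      · rw [hT, ht]; simp
      · rw [hA, hbu]; simp
    have h2 := take_X hI hX
    have hin2 : ∑ w ∈ NB G v, take (ctxG G s hs) w v ≤ 2 := by
      rw [hbu, Finset.sum_insert (by simp [hab, hac]), Finset.sum_pair hbc]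
      omega
    rw [hb, ht]; simp only [Finset.card_empty]; push_cast; omega

noncomputable def flow (C : Ctx V) (G : SimpleGraph V) (v w : V) : ℤ :=
  (if G.Adj v w ∧ Is2 G w then 4 else 0) + take C w v

lemma flow_out (C : Ctx V) (v : V) :
    ∑ w, flow C G v w = 4 * ((NT G v).card : ℤ) + ∑ w, take C w v := by
  unfold flow NT
  rw [Finset.sum_add_distrib, ← Finset.sum_filter, Finset.sum_const, nsmul_eq_mul, mul_comm]

lemma final_charge (hs : ∀ x y, s x y = s y x)
    (hG : ∀ S : V → Prop, (∃ x, S x) → ¬ GRed G s S) (v : V) :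
    28 + ∑ w, flow (ctxG G s hs) G v w ≤
      10 * (G.degree v : ℤ) + ∑ w, flow (ctxG G s hs) G w v := by
  rw [flow_out]
  by_cases hv : Is2 G v
  · have h0 : NT G v = ∅ := by
      rw [Finset.eq_empty_iff_forall_notMem]
      intro w hw
      obtain ⟨h1, h2⟩ := mem_NT.1 hw
      exact no_22 hs hG hv h2 h1
    have h1 : ∑ w, take (ctxG G s hs) w v = 0 :=
      Finset.sum_eq_zero fun w _ => take_not fun h => h.2.2.2 hv
    have h2 : (8 : ℤ) ≤ ∑ w, flow (ctxG G s hs) G w v := by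
      have : ∑ w, (if G.Adj w v ∧ Is2 G v then (4 : ℤ) else 0) = 8 := by
        rw [← Finset.sum_filter, Finset.sum_const]
        have hd := deg_of_is2 hv
        rw [← G.card_neighborFinset_eq_degree] at hd
        have he : Finset.univ.filter (fun w => G.Adj w v ∧ Is2 G v) = G.neighborFinset v := by
          ext w; simp [hv, G.adj_comm]
        rw [he, hd]; norm_num
      rw [← this]
      apply Finset.sum_le_sum
      intro w _
      unfold flow
      have := take_nonneg (C := ctxG G s hs) v w
      omega
    rw [h0, h1, deg_of_is2 hv]; simp only [Finset.card_empty]; push_cast; omega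
  · have := big_charge hs hG hv
    rw [take_in hs hv]
    have h2 : ∑ w, take (ctxG G s hs) v w ≤ ∑ w, flow (ctxG G s hs) G w v := by
      apply Finset.sum_le_sum
      intro w _
      unfold flow
      split_ifs <;> omega
    omega

theorem discharge (hs : ∀ x y, s x y = s y x)
    (hG : ∀ S : V → Prop, (∃ x, S x) → ¬ GRed G s S) :
    28 * (Fintype.card V : ℤ) ≤ 10 * ((∑ v, G.degree v : ℕ) : ℤ) := by
  have h := Finset.sum_le_sum fun v (_ : v ∈ Finset.univ) => final_charge hs hG v
  rw [Finset.sum_add_distrib, Finset.sum_add_distrib, Finset.sum_comm, ← Finset.mul_sum] at h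
  simp only [Finset.sum_const, Finset.card_univ, nsmul_eq_mul] at h
  push_cast
  linarith

end
end K6M


/-! ### The final argument -/

namespace K6M

section
open Classical

variable {V : Type*} [Fintype V] {G : SimpleGraph V} {s : V → V → Bool}

lemma colourable (hs : ∀ x y, s x y = s y x) (hmad : MadLT G (14 / 5)) (W : Finset V) :
    ∃ f : V → Col, ∀ x ∈ W, ∀ y ∈ W, G.Adj x y → ok (s x y) (f x) (f y) = true := by
  induction W using Finset.strongInduction with
  | H W ih =>
  by_contra hno
  have hne : (W : Set V).Nonempty := by
    rw [Finset.coe_nonempty]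
    by_contra he
    rw [Finset.not_nonempty_iff_eq_empty] at he
    exact hno ⟨fun _ => 0, by simp [he]⟩
  let s' : ↥(W : Set V) → ↥(W : Set V) → Bool := fun x y => s x.1 y.1
  have hs' : ∀ x y, s' x y = s' y x := fun x y => hs _ _
  have hG' : ∀ S : ↥(W : Set V) → Prop, (∃ x, S x) → ¬ GRed (G.induce (W : Set V)) s' S := by
    rintro S ⟨⟨x0, hx0⟩, hS0⟩ hR
    obtain ⟨f, hf⟩ := ih (W.filter fun x => ∀ h : x ∈ (W : Set V), ¬ S ⟨x, h⟩) (by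
      rw [Finset.filter_ssubset]
      exact ⟨x0, by simpa using hx0, fun h => h hx0 hS0⟩)
    obtain ⟨g, h1, h2⟩ := hR fun x => f x.1
    apply hno
    refine ⟨fun x => if h : x ∈ (W : Set V) then g ⟨x, h⟩ else 0, fun x hx y hy hA => ?_⟩
    have hx' : x ∈ (W : Set V) := hx
    have hy' : y ∈ (W : Set V) := hy
    simp only [dif_pos hx', dif_pos hy']
    by_cases hSx : S ⟨x, hx'⟩
    · exact h2 _ hSx ⟨y, hy'⟩ hA
    by_cases hSy : S ⟨y, hy'⟩
    · rw [hs, ok_symm]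
      exact h2 _ hSy ⟨x, hx'⟩ hA.symm
    rw [h1 _ hSx, h1 _ hSy]
    exact hf x (Finset.mem_filter.2 ⟨hx, fun _ => hSx⟩) y
      (Finset.mem_filter.2 ⟨hy, fun _ => hSy⟩) hA
  have hd := discharge hs' hG'
  rw [SimpleGraph.sum_degrees_eq_twice_card_edges] at hd
  have hm := hmad ((⊤ : G.Subgraph).induce (W : Set V)) hne
  have hle : (G.induce (W : Set V)).edgeFinset.card ≤
      ((⊤ : G.Subgraph).induce (W : Set V)).edgeSet.ncard := by
    rw [← Set.ncard_coe_finset, SimpleGraph.coe_edgeFinset,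
      ← Set.ncard_image_of_injective _ (Sym2.map.injective Subtype.val_injective)]
    apply Set.ncard_le_ncard _ (Set.toFinite _)
    rintro _ ⟨e, he, rfl⟩
    induction e with
    | _ x y =>
      simp only [Sym2.map_mk, SimpleGraph.Subgraph.mem_edgeSet, SimpleGraph.Subgraph.induce_adj]
      exact ⟨x.2, y.2, he⟩
  have hv : ((⊤ : G.Subgraph).induce (W : Set V)).verts.ncard =
      Fintype.card (W : Set V) := by
    rw [← Nat.card_eq_fintype_card]; rfl
  rw [hv] at hm
  have hle' : ((G.induce (W : Set V)).edgeFinset.card : ℚ) ≤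
      (((⊤ : G.Subgraph).induce (W : Set V)).edgeSet.ncard : ℚ) := by exact_mod_cast hle
  have hd' : 28 * (Fintype.card (W : Set V) : ℚ) ≤
      10 * (2 * ((G.induce (W : Set V)).edgeFinset.card : ℚ)) := by exact_mod_cast hd
  linarith

end

def sg (a : Col) : ℤˣ := if a.val % 2 = 0 then 1 else -1
def vx (a : Col) : Fin 6 := ⟨a.val / 2, by omega⟩

lemma ok_vx : ∀ n a b, ok n a b = true → vx a ≠ vx b := by decide +kernel

lemma sg_sq (a : Col) : sg a * sg a = 1 := Int.units_mul_self _

lemma ok_sign : ∀ n a b, ok n a b = true → matchSign 6 s(vx a, vx b) =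
    sg a * (if n then -1 else 1) * sg b := by decide +kernel

lemma walk_sign {V : Type*} {G : SimpleGraph V} {σ : Sym2 V → ℤˣ} (f : V → Col)
    (h : G →g (⊤ : SimpleGraph (Fin 6))) (hh : ∀ v, h v = vx (f v))
    (hf : ∀ x y, G.Adj x y → ok (decide (σ s(x, y) = -1)) (f x) (f y) = true)
    {u v : V} (w : G.Walk u v) :
    walkSign (matchSign 6) (w.map h) = sg (f u) * walkSign σ w * sg (f v) := by
  induction w with
  | nil => simp [walkSign]
  | @cons u v x huv w ih =>
    have e1 : walkSign (matchSign 6) ((Walk.cons huv w).map h) =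
        matchSign 6 s(h u, h v) * walkSign (matchSign 6) (w.map h) := by
      simp [walkSign]
    have e2 : walkSign σ (Walk.cons huv w) = σ s(u, v) * walkSign σ w := by
      simp [walkSign]
    have e3 : (if decide (σ s(u, v) = -1) = true then (-1 : ℤˣ) else 1) = σ s(u, v) := by
      rcases Int.units_eq_one_or (σ s(u, v)) with e | e <;> rw [e] <;> decide
    rw [e1, e2, ih, hh, hh, ok_sign _ _ _ (hf u v huv), e3]
    calc sg (f u) * σ s(u, v) * sg (f v) * (sg (f v) * walkSign σ w * sg (f x))
        = sg (f u) * (σ s(u, v) * (sg (f v) * sg (f v)) * walkSign σ w) * sg (f x) := by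
          simp only [mul_assoc]
      _ = _ := by rw [sg_sq, mul_one]

end K6M

/-- Every signed graph with maximum average degree less than `14/5` admits a homomorphism to
`(K_6, M)`. -/
theorem signedHom_K6M_of_madLT {V : Type*} [Fintype V]
    (G : SimpleGraph V) (σ : Sym2 V → ℤˣ) (hmad : MadLT G (14 / 5)) :
    SignedHom G σ (⊤ : SimpleGraph (Fin 6)) (matchSign 6) := by
  obtain ⟨f, hf⟩ := K6M.colourable (G := G) (s := fun x y => decide (σ s(x, y) = -1))
    (fun x y => by rw [Sym2.eq_swap]) hmad Finset.univ
  have hf' : ∀ x y, G.Adj x y → K6M.ok (decide (σ s(x, y) = -1)) (f x) (f y) = true :=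
    fun x y h => hf x (Finset.mem_univ _) y (Finset.mem_univ _) h
  refine ⟨⟨fun v => K6M.vx (f v), fun {a b} h => K6M.ok_vx _ _ _ (hf' a b h)⟩, fun u w => ?_⟩
  rw [K6M.walk_sign f _ (fun v => rfl) hf' w, mul_comm, ← mul_assoc, K6M.sg_sq, one_mul]
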